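/- For every ε ∈ (0,1) there is a constant c₅(ε) depending only on d ≥ 3 and ε such that: for every integer L ≥ 1, every integer K ≥ c₅(ε) with K ≥ 100, and every nonempty finite subset 𝒞 of 𝕃 = Lℤ^d whose points are at mutual ℓ∞-distance at least (2K+3)L, setting C = ∪_{z∈𝒞} D_z and V(x) = Σ_{z∈𝒞} e_C(D_z)·ē_{D_z}(x) (where e_C(D_z) = Σ_{y∈D_z} e_C(y)), one has GV(x) ≤ (1+ε)·h_C(x) for all x ∈ ℤ^d, where h_C = G e_C is the equilibrium potential of C. -/

import Mathlib

open MeasureTheory ENNReal Set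
open scoped Classical NNReal

namespace Disconnection

/-- Points of `ℤ^d`. -/
abbrev Zd (d : ℕ) := Fin d → ℤ

/-- Step distribution of the simple random walk: uniform weight `1/(2d)` on each of the
`2d` unit vectors of `ℤ^d`. -/
noncomputable def stepP (d : ℕ) (v : Zd d) : ℝ≥0∞ :=
  if (∑ i, (v i).natAbs) = 1 then ((2 * d : ℕ) : ℝ≥0∞)⁻¹ else 0

/-- The exponential distribution of rate `1` on `[0,∞)` (as a measure on `ℝ`). -/
noncomputable def expMeasure : Measure ℝ :=
  MeasureTheory.volume.withDensity fun t => ENNReal.ofReal (if 0 < t then Real.exp (-t) else 0)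

/-- Nearest neighbours in `ℤ^d` (Euclidean distance one). -/
def adjacent {d : ℕ} (x y : Zd d) : Prop := (∑ i, (x i - y i).natAbs) = 1

/-- (Outer) boundary `∂A` of a set `A ⊆ ℤ^d`. -/
def bdry {d : ℕ} (A : Set (Zd d)) : Set (Zd d) := {y | y ∉ A ∧ ∃ x ∈ A, adjacent x y}

/-- sup-norm distance between two points of `ℤ^d`. -/
def supDist {d : ℕ} (x y : Zd d) : ℕ := Finset.univ.sup fun i => (x i - y i).natAbs

/-- closed sup-norm ball `B(x,r)` in `ℤ^d`. -/
def ball {d : ℕ} (x : Zd d) (r : ℕ) : Set (Zd d) := {y | supDist x y ≤ r}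

/-- mutual sup-norm distance between two sets. -/
noncomputable def setDist {d : ℕ} (A B : Set (Zd d)) : ℕ := sInf {n | ∃ x ∈ A, ∃ y ∈ B, supDist x y = n}

/-- the box `ℤ^d ∩ [a,b)^d`. -/
def intBox {d : ℕ} (a b : ℤ) : Set (Zd d) := {y | ∀ i, a ≤ y i ∧ y i < b}

/-- A box in `ℤ^d`: a translate of `[0,L)^d ∩ ℤ^d` with `L ≥ 1`. -/
def isBox {d : ℕ} (S : Set (Zd d)) : Prop :=
  ∃ L : ℕ, 1 ≤ L ∧ ∃ a : Zd d, S = {y | ∀ i, a i ≤ y i ∧ y i < a i + L}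

/-- connectedness of a subset of `ℤ^d` by nearest-neighbour paths. -/
def connSet {d : ℕ} (S : Set (Zd d)) : Prop :=
  ∀ a ∈ S, ∀ b ∈ S, ∃ (n : ℕ) (f : ℕ → Zd d), f 0 = a ∧ f n = b ∧
    (∀ k ≤ n, f k ∈ S) ∧ ∀ k < n, adjacent (f k) (f (k + 1))

/-- Euclidean norm of a lattice point. -/
noncomputable def eucNorm {d : ℕ} (x : Zd d) : ℝ := Real.sqrt (∑ i, ((x i : ℝ)) ^ 2)

/-- A model of the continuous-time simple random walk on `ℤ^d` with unit jump rate: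
`Y` is the discrete jump chain and `ζ` are the holding times; under `P x` one has
`Y 0 = x` a.s., and the increments of `Y` together with the holding times are mutually
independent, the increments uniform on the `2d` unit vectors and the holding times
exponential of rate `1`.  This is expressed through the finite-dimensional cylinder
probabilities, which determine the joint law. -/
structure SRW (d : ℕ) (Ω : Type*) [MeasurableSpace Ω] where
  P : Zd d → Measure Ω
  isProb : ∀ x, IsProbabilityMeasure (P x)
  Y : ℕ → Ω → Zd d
  ζ : ℕ → Ω → ℝ
  measurable_Y : ∀ n, Measurable (Y n)
  measurable_ζ : ∀ n, Measurable (ζ n)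
  Y_zero : ∀ x : Zd d, P x {ω | Y 0 ω = x} = 1
  law : ∀ (x : Zd d) (n : ℕ) (s : Fin n → Zd d) (I : Fin n → Set ℝ),
    (∀ i, MeasurableSet (I i)) →
    P x {ω | (∀ i : Fin n, Y ((i : ℕ) + 1) ω - Y (i : ℕ) ω = s i) ∧
             (∀ i : Fin n, ζ (i : ℕ) ω ∈ I i)}
      = (∏ i, stepP d (s i)) * ∏ i, expMeasure (I i)

namespace SRW

variable {d : ℕ} {Ω : Type*} [MeasurableSpace Ω]

/-- time of the `n`-th jump. -/
noncomputable def S (W : SRW d Ω) (n : ℕ) (ω : Ω) : ℝ := ∑ i ∈ Finset.range n, W.ζ i ω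

/-- index of the current step of the jump chain at time `t`. -/
noncomputable def jumpIdx (W : SRW d Ω) (t : ℝ) (ω : Ω) : ℕ := sSup {k : ℕ | W.S k ω ≤ t}

/-- the continuous-time walk `X_t`. -/
noncomputable def X (W : SRW d Ω) (t : ℝ) (ω : Ω) : Zd d := W.Y (W.jumpIdx t ω) ω

/-- entrance time of `A` after time `t` (`∞` if there is none). -/
noncomputable def hitFrom (W : SRW d Ω) (A : Set (Zd d)) (t : ℝ≥0∞) (ω : Ω) : ℝ≥0∞ :=
  sInf {u : ℝ≥0∞ | ∃ s : ℝ≥0, u = (s : ℝ≥0∞) ∧ t ≤ u ∧ W.X (s : ℝ) ω ∈ A}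

/-- entrance time `H_A = inf {t ≥ 0 : X_t ∈ A}`. -/
noncomputable def hit (W : SRW d Ω) (A : Set (Zd d)) (ω : Ω) : ℝ≥0∞ := W.hitFrom A 0 ω

/-- exit time `T_U = inf {t ≥ 0 : X_t ∉ U}`. -/
noncomputable def exit (W : SRW d Ω) (U : Set (Zd d)) (ω : Ω) : ℝ≥0∞ := W.hit Uᶜ ω

/-- hitting time `H̃_A = inf {t ≥ ζ₀ : X_t ∈ A}`. -/
noncomputable def hitTilde (W : SRW d Ω) (A : Set (Zd d)) (ω : Ω) : ℝ≥0∞ :=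
  W.hitFrom A (ENNReal.ofReal (W.ζ 0 ω)) ω

/-- the walk evaluated at a random (possibly infinite) time. -/
noncomputable def Xat (W : SRW d Ω) (τ : Ω → ℝ≥0∞) (ω : Ω) : Zd d := W.X (τ ω).toReal ω

/-- equilibrium measure `e_A(x) = P_x[H̃_A = ∞] 1_A(x)`. -/
noncomputable def eqm (W : SRW d Ω) (A : Set (Zd d)) (x : Zd d) : ℝ :=
  if x ∈ A then (W.P x {ω | W.hitTilde A ω = ⊤}).toReal else 0

/-- capacity `cap(A) = Σ_x e_A(x)`. -/
noncomputable def cap (W : SRW d Ω) (A : Set (Zd d)) : ℝ := ∑ᶠ x, W.eqm A x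

/-- normalized equilibrium measure `ē_A = e_A / cap(A)`. -/
noncomputable def ebar (W : SRW d Ω) (A : Set (Zd d)) (x : Zd d) : ℝ := W.eqm A x / W.cap A

/-- equilibrium measure of `A` relative to `U`: `e_{A,U}(x) = P_x[H̃_A > T_U] 1_A(x)`. -/
noncomputable def eqmRel (W : SRW d Ω) (A U : Set (Zd d)) (x : Zd d) : ℝ :=
  if x ∈ A then (W.P x {ω | W.exit U ω < W.hitTilde A ω}).toReal else 0

/-- `P_ρ = Σ_x ρ(x) P_x`, the walk started from the initial (sub-)measure with density `ρ`. -/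
noncomputable def Pinit (W : SRW d Ω) (ρ : Zd d → ℝ) : Measure Ω :=
  Measure.sum fun x : Zd d => ENNReal.ofReal (ρ x) • W.P x

/-- Green function `g(x,y) = E_x[∫₀^∞ 1{X_s = y} ds]`. -/
noncomputable def green (W : SRW d Ω) (x y : Zd d) : ℝ :=
  ∫ ω, (∫ s in Set.Ioi (0 : ℝ), if W.X s ω = y then (1 : ℝ) else 0) ∂ W.P x

/-- killed Green function `g_U(x,y) = E_x[∫₀^{T_U} 1{X_s = y} ds]`. -/
noncomputable def greenK (W : SRW d Ω) (U : Set (Zd d)) (x y : Zd d) : ℝ :=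
  ∫ ω, (∫ s in Set.Ioi (0 : ℝ),
      if ENNReal.ofReal s < W.exit U ω ∧ W.X s ω = y then (1 : ℝ) else 0) ∂ W.P x

/-- the potential operator `Gf(x) = Σ_y g(x,y) f(y)`. -/
noncomputable def Gop (W : SRW d Ω) (f : Zd d → ℝ) (x : Zd d) : ℝ :=
  ∑ᶠ y, W.green x y * f y

/-- successive return times to `A` (between excursions out of `U`): `Rt A U 0 = R₁ = H_A`. -/
noncomputable def Rt (W : SRW d Ω) (A U : Set (Zd d)) : ℕ → Ω → ℝ≥0∞
  | 0 => W.hit A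
  | k + 1 => fun ω => W.hitFrom A (W.hitFrom Uᶜ (W.Rt A U k ω) ω) ω

/-- successive departure times from `U`: `Dt A U k = D_{k+1}`. -/
noncomputable def Dt (W : SRW d Ω) (A U : Set (Zd d)) (k : ℕ) (ω : Ω) : ℝ≥0∞ :=
  W.hitFrom Uᶜ (W.Rt A U k ω) ω

/-- number of excursions from `A` to the complement of `U`:
`N_{A,U} = sup {k ≥ 1 : D_k < ∞}` (with `sup ∅ = 0`). -/
noncomputable def Nexc (W : SRW d Ω) (A U : Set (Zd d)) (ω : Ω) : ℕ :=
  sSup {n | 0 < n ∧ W.Dt A U (n - 1) ω < ⊤}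

end SRW

end Disconnection

open Disconnection

namespace Aux

noncomputable section

variable {d : ℕ}

abbrev ee (i : Fin d) : Zd d := Pi.single i 1

def avg (f : Zd d → ℝ) (x : Zd d) : ℝ :=
  (∑ i, (f (x + ee i) + f (x - ee i))) / (2 * d)

lemma avg_mono {f h : Zd d → ℝ} (H : ∀ x, f x ≤ h x) (x : Zd d) : avg f x ≤ avg h x := by
  unfold avg
  gcongr <;> apply H

lemma avg_sub (f h : Zd d → ℝ) (x : Zd d) :
    avg (fun y => f y - h y) x = avg f x - avg h x := by
  unfold avg
  rw [← sub_div, ← Finset.sum_sub_distrib]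
  congr 1
  apply Finset.sum_congr rfl
  intros; ring

lemma avg_add (f h : Zd d → ℝ) (x : Zd d) :
    avg (fun y => f y + h y) x = avg f x + avg h x := by
  unfold avg
  rw [← add_div, ← Finset.sum_add_distrib]
  congr 1
  apply Finset.sum_congr rfl
  intros; ring

lemma avg_mul (c : ℝ) (f : Zd d → ℝ) (x : Zd d) :
    avg (fun y => c * f y) x = c * avg f x := by
  unfold avg
  rw [mul_div_assoc', Finset.mul_sum]
  congr 1
  apply Finset.sum_congr rfl
  intros; ring

lemma avg_const (hd : 0 < d) (c : ℝ) (x : Zd d) :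
    avg (fun _ => c) x = c := by
  unfold avg
  have : (d : ℝ) ≠ 0 := by positivity
  simp
  field_simp
  ring

lemma avg_sum {ι : Type*} (s : Finset ι) (f : ι → Zd d → ℝ) (x : Zd d) :
    avg (fun y => ∑ i ∈ s, f i y) x = ∑ i ∈ s, avg (f i) x := by
  unfold avg
  rw [← Finset.sum_div]
  congr 1
  rw [Finset.sum_comm]
  apply Finset.sum_congr rfl
  intros; rw [Finset.sum_add_distrib]

lemma minP (hd : 0 < d) (u : Zd d → ℝ) (H : Set (Zd d))
    (hfin : ∀ c < 0, {x | x ∈ H ∧ u x ≤ c}.Finite)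
    (hsup : ∀ x ∈ H, avg u x ≤ u x)
    (hb : ∀ x ∈ H, u x < 0 → ∀ i, (x + ee i ∉ H → u x < u (x + ee i)) ∧
      (x - ee i ∉ H → u x < u (x - ee i))) :
    ∀ x ∈ H, 0 ≤ u x := by
  intro x0 hx0
  by_contra! hneg
  have hf := hfin (u x0) hneg
  obtain ⟨x1, hx1, hmin⟩ := Set.exists_min_image _ u hf ⟨x0, hx0, le_rfl⟩
  have hf2 : {x | x ∈ H ∧ u x ≤ u x1}.Finite := hfin _ (lt_of_le_of_lt hx1.2 hneg)
  let i0 : Fin d := ⟨0, hd⟩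
  obtain ⟨x2, hx2, hmax⟩ := Set.exists_max_image _ (fun x => x i0) hf2 ⟨x1, hx1.1, le_rfl⟩
  have hm : ∀ y ∈ H, u x2 ≤ u y := by
    intro y hy
    by_cases h : u y ≤ u x0
    · exact hx2.2.trans (hmin y ⟨hy, h⟩)
    · push Not at h
      exact hx2.2.trans (hx1.2.trans h.le)
  have hx2n : u x2 < 0 := lt_of_le_of_lt hx2.2 (lt_of_le_of_lt hx1.2 hneg)
  have hp : ∀ i, u x2 ≤ u (x2 + ee i) := by
    intro i
    by_cases h : x2 + ee i ∈ H
    · exact hm _ h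
    · exact ((hb x2 hx2.1 hx2n i).1 h).le
  have hq : ∀ i, u x2 ≤ u (x2 - ee i) := by
    intro i
    by_cases h : x2 - ee i ∈ H
    · exact hm _ h
    · exact ((hb x2 hx2.1 hx2n i).2 h).le
  have key : u (x2 + ee i0) ≤ u x2 := by
    by_contra! hlt
    have h1 := hsup x2 hx2.1
    unfold avg at h1
    have hdpos : (0:ℝ) < 2 * d := by positivity
    rw [div_le_iff₀ hdpos] at h1
    have h2 : ∑ i : Fin d, (u x2 + u x2) < ∑ i, (u (x2 + ee i) + u (x2 - ee i)) := by
      apply Finset.sum_lt_sum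
      · intro i _
        exact add_le_add (hp i) (hq i)
      · exact ⟨i0, Finset.mem_univ _, add_lt_add_of_lt_of_le hlt (hq i0)⟩
    simp at h2
    nlinarith
  by_cases h : x2 + ee i0 ∈ H
  · have := hmax _ ⟨h, key.trans hx2.2⟩
    simp [ee] at this
  · exact absurd key (not_le.mpr ((hb x2 hx2.1 hx2n i0).1 h))

/-! transition probabilities -/

def p : ℕ → Zd d → ℝ
  | 0 => fun x => if x = 0 then 1 else 0
  | n + 1 => fun x => avg (p n) x

lemma p_nonneg (n : ℕ) (x : Zd d) : 0 ≤ p n x := by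
  induction n generalizing x with
  | zero => simp only [p]; split_ifs <;> norm_num
  | succ n ih =>
    simp only [p, avg]
    apply div_nonneg _ (by positivity)
    exact Finset.sum_nonneg fun i _ => add_nonneg (ih _) (ih _)

lemma p_neg (n : ℕ) (x : Zd d) : p n (-x) = p n x := by
  induction n generalizing x with
  | zero => simp [p]
  | succ n ih =>
    simp only [p, avg]
    congr 1
    apply Finset.sum_congr rfl
    intro i _
    rw [← ih (-x + ee i), ← ih (-x - ee i), add_comm]
    congr 2 <;> abel

def G0 (x : Zd d) : ℝ := ∑' n, p n x

lemma G0_nonneg (x : Zd d) : 0 ≤ G0 x := tsum_nonneg fun n => p_nonneg n x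

lemma G0_neg (x : Zd d) : G0 (-x) = G0 x := by simp [G0, p_neg]

lemma quart (s : ℝ) (hs : |s| ≤ 1/100) :
    1 ≤ (1 + s) * (1 - s/4 + 17/100 * s^2)^4 := by
  obtain ⟨h1, h2⟩ := abs_le.mp hs
  have hq : 1 - s/2 + 0.4 * s^2 ≤ (1 - s/4 + 17/100 * s^2)^2 := by
    nlinarith [sq_nonneg s, sq_nonneg (s^2), mul_nonneg (sq_nonneg s) (sub_nonneg.mpr h2)]
  have hq2 : 1 - s + 1.04 * s^2 ≤ (1 - s/4 + 17/100 * s^2)^4 := by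
    have h0 : 0 ≤ 1 - s/2 + 0.4 * s^2 := by nlinarith [sq_nonneg s]
    have := mul_self_le_mul_self h0 hq
    nlinarith [sq_nonneg s, sq_nonneg (s^2), mul_nonneg (sq_nonneg s) (sub_nonneg.mpr h2)]
  have h5 : (1 + s) * (1 - s + 1.04 * s^2) ≤ (1 + s) * (1 - s/4 + 17/100 * s^2)^4 :=
    mul_le_mul_of_nonneg_left hq2 (by linarith)
  nlinarith [mul_nonneg (sq_nonneg s) (by linarith : 0 ≤ s + 1/100)]

def rr (x : Zd d) : ℝ := ∑ i, (x i : ℝ)^2 + 20000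

def psi (x : Zd d) : ℝ := (rr x) ^ (-(1/4) : ℝ)

lemma rr_ge (x : Zd d) (i : Fin d) : (x i : ℝ)^2 + 20000 ≤ rr x := by
  unfold rr
  gcongr
  exact Finset.single_le_sum (f := fun i => (x i : ℝ)^2) (fun j _ => sq_nonneg _) (Finset.mem_univ i)

lemma rr_ge' (x : Zd d) : 20000 ≤ rr x := by
  unfold rr
  have : 0 ≤ ∑ i, (x i : ℝ)^2 := Finset.sum_nonneg fun j _ => sq_nonneg _
  linarith

lemma sq_sum_upd (x : Zd d) (i : Fin d) (t : ℤ) :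
    ∑ j, (((x + t • ee i) j : ℤ) : ℝ)^2 = ∑ j, (x j : ℝ)^2 + t^2 + 2 * t * x i := by
  have : ∀ j, (((x + t • ee i) j : ℤ) : ℝ)^2 = (x j : ℝ)^2 + if j = i then (t^2 + 2 * t * x i : ℝ) else 0 := by
    intro j
    by_cases h : j = i
    · subst h; simp; ring
    · simp [h]
  simp_rw [this]
  rw [Finset.sum_add_distrib]
  simp
  ring

lemma rr_add (x : Zd d) (i : Fin d) : rr (x + ee i) = rr x + (1 + 2 * x i) := by
  have := sq_sum_upd x i 1
  simp only [one_smul] at this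
  unfold rr; rw [this]; push_cast; ring

lemma rr_sub (x : Zd d) (i : Fin d) : rr (x - ee i) = rr x + (1 - 2 * x i) := by
  have := sq_sum_upd x i (-1)
  simp only [neg_smul, one_smul, ← sub_eq_add_neg] at this
  unfold rr; rw [this]; push_cast; ring

lemma pow_bd (r t : ℝ) (hr : 0 < r) (ht : |t| * 100 ≤ r) :
    (r + t) ^ (-(1/4) : ℝ) ≤ r ^ (-(1/4) : ℝ) * (1 - (t/r)/4 + 17/100 * (t/r)^2) := by
  set s := t / r with hs
  have hs1 : |s| ≤ 1/100 := by
    rw [hs, abs_div, abs_of_pos hr, div_le_iff₀ hr]; linarith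
  have hq := quart s hs1
  obtain ⟨h1, h2⟩ := abs_le.mp hs1
  have he : r + t = r * (1 + s) := by rw [hs]; field_simp
  have h1s : 0 < 1 + s := by linarith
  rw [he, Real.mul_rpow hr.le h1s.le]
  gcongr
  have hpp : 0 < 1 - s/4 + 17/100 * s^2 := by nlinarith [sq_nonneg s]
  have e1 : 1 - s/4 + 17/100 * s^2 = ((1 - s/4 + 17/100 * s^2)^4) ^ (1/4 : ℝ) := by
    rw [← Real.rpow_natCast (_) 4, ← Real.rpow_mul hpp.le]; norm_num
  rw [e1, Real.rpow_neg h1s.le, ← Real.inv_rpow h1s.le]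
  apply Real.rpow_le_rpow (by positivity) _ (by norm_num)
  rw [inv_le_iff_one_le_mul₀ h1s]
  linarith

lemma psi_super (hd : 3 ≤ d) (x : Zd d) : avg psi x < psi x := by
  have hd' : (3:ℝ) ≤ d := by exact_mod_cast hd
  have hr : 0 < rr x := lt_of_lt_of_le (by norm_num) (rr_ge' x)
  have hpos : 0 < psi x := Real.rpow_pos_of_pos hr _
  have hb : ∀ i, psi (x + ee i) + psi (x - ee i) ≤
      psi x * (2 - 1/(2 * rr x) + 17/100 * (2 + 8 * (x i : ℝ)^2) / (rr x)^2) := by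
    intro i
    have hri := rr_ge x i
    have a1 : |1 + 2 * (x i : ℝ)| * 100 ≤ rr x := by
      rw [← le_div_iff₀ (by norm_num), abs_le]
      constructor <;> nlinarith [sq_nonneg ((x i : ℝ) - 100), sq_nonneg ((x i : ℝ) + 100)]
    have a2 : |1 - 2 * (x i : ℝ)| * 100 ≤ rr x := by
      rw [← le_div_iff₀ (by norm_num), abs_le]
      constructor <;> nlinarith [sq_nonneg ((x i : ℝ) - 100), sq_nonneg ((x i : ℝ) + 100)]
    have b1 := pow_bd _ _ hr a1
    have b2 := pow_bd _ _ hr a2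
    unfold psi
    rw [rr_add, rr_sub]
    refine (add_le_add b1 b2).trans (le_of_eq ?_)
    rw [← mul_add]
    congr 1
    field_simp
    ring
  have hsum : ∑ i, (psi (x + ee i) + psi (x - ee i)) ≤
      psi x * (2 * d - d/(2 * rr x) + 17/100 * (2 * d + 8 * (rr x - 20000)) / (rr x)^2) := by
    refine (Finset.sum_le_sum fun i _ => hb i).trans (le_of_eq ?_)
    rw [← Finset.mul_sum]
    congr 1
    rw [Finset.sum_add_distrib, ← Finset.sum_div, ← Finset.mul_sum, Finset.sum_add_distrib,
      ← Finset.mul_sum]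
    simp only [Finset.sum_const, Finset.card_univ, Fintype.card_fin, nsmul_eq_mul]
    have : ∑ i, (x i : ℝ)^2 = rr x - 20000 := by unfold rr; ring
    rw [this]
    ring
  unfold avg
  rw [div_lt_iff₀ (by positivity)]
  refine lt_of_le_of_lt hsum ?_
  apply mul_lt_mul_of_pos_left _ hpos
  have : 17/100 * (2 * d + 8 * (rr x - 20000)) / (rr x)^2 < d/(2 * rr x) := by
    rw [div_lt_div_iff₀ (by positivity) (by positivity)]
    have h := rr_ge' x
    have h2 : 17/100 * (2 * d + 8 * (rr x - 20000)) * 2 < d * rr x := by nlinarith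
    nlinarith
  linarith

lemma psum_le (hd : 3 ≤ d) : ∃ c : ℝ, 0 < c ∧ ∀ N (x : Zd d),
    ∑ n ∈ Finset.range N, p n x ≤ c * psi x := by
  have h0 := psi_super hd (0 : Zd d)
  refine ⟨(psi (0 : Zd d) - avg psi (0 : Zd d))⁻¹, inv_pos.mpr (sub_pos.mpr h0), ?_⟩
  set c := psi (0 : Zd d) - avg psi (0 : Zd d) with hc
  have hc0 : 0 < c := sub_pos.mpr h0
  intro N
  induction N with
  | zero =>
    intro x
    have : 0 < rr x := lt_of_lt_of_le (by norm_num) (rr_ge' x)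
    have : 0 < psi x := Real.rpow_pos_of_pos this _
    simp; positivity
  | succ N ih =>
    intro x
    rw [Finset.sum_range_succ']
    have h1 : ∑ n ∈ Finset.range N, p (n+1) x ≤ c⁻¹ * avg psi x := by
      simp only [p]
      rw [← avg_sum, ← avg_mul]
      exact avg_mono ih x
    have h2 : p 0 x ≤ c⁻¹ * (psi x - avg psi x) := by
      simp only [p]
      split_ifs with h
      · subst h; rw [← hc, inv_mul_cancel₀ hc0.ne']
      · have := psi_super hd x
        apply mul_nonneg (inv_pos.mpr hc0).le; linarith
    linarith

lemma p_summable (hd : 3 ≤ d) (x : Zd d) : Summable (fun n => p n x) := by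
  obtain ⟨c, hc, h⟩ := psum_le hd
  exact summable_of_sum_range_le (fun n => p_nonneg n x) (fun N => h N x)

lemma G0_eq (hd : 3 ≤ d) (x : Zd d) : G0 x = (if x = 0 then 1 else 0) + avg G0 x := by
  have hs := p_summable hd
  unfold G0
  rw [(hs x).tsum_eq_zero_add]
  congr 1
  simp only [p, avg]
  rw [tsum_div_const, Summable.tsum_finsetSum]
  · congr 1
    apply Finset.sum_congr rfl
    intro i _
    rw [(hs _).tsum_add (hs _)]
  · intro i _
    exact (hs _).add (hs _)

lemma G0_super (hd : 3 ≤ d) (x : Zd d) : avg G0 x ≤ G0 x := by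
  have := G0_eq hd x
  split_ifs at this <;> linarith

lemma G0_harm (hd : 3 ≤ d) (x : Zd d) (hx : x ≠ 0) : avg G0 x = G0 x := by
  have := G0_eq hd x
  rw [if_neg hx] at this; linarith

lemma G0_decay (hd : 3 ≤ d) (c : ℝ) (hc : 0 < c) : {x : Zd d | c ≤ G0 x}.Finite := by
  obtain ⟨C, hC, h⟩ := psum_le hd
  have hle : ∀ x : Zd d, G0 x ≤ C * psi x := fun x =>
    Real.tsum_le_of_sum_range_le (fun n => p_nonneg n x) (fun N => h N x)
  obtain ⟨B, hB⟩ : ∃ B : ℕ, (C / c)^4 ≤ B := exists_nat_ge _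
  apply (Set.finite_Icc (fun _ : Fin d => -(B:ℤ)) (fun _ => (B:ℤ))).subset
  intro x hx
  have h1 : c ≤ C * psi x := le_trans hx (hle x)
  have hr : 0 < rr x := lt_of_lt_of_le (by norm_num) (rr_ge' x)
  have h2 : (psi x)⁻¹ ≤ C / c := by
    have : 0 < psi x := Real.rpow_pos_of_pos hr _
    rw [inv_le_iff_one_le_mul₀ this, div_mul_eq_mul_div, le_div_iff₀ hc]; linarith
  have h3 : rr x ≤ B := by
    refine le_trans ?_ hB
    have : rr x = ((psi x)⁻¹)^4 := by
      unfold psi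
      rw [← Real.rpow_neg hr.le, ← Real.rpow_natCast, ← Real.rpow_mul hr.le]; norm_num
    rw [this]
    have : 0 < psi x := Real.rpow_pos_of_pos hr _
    gcongr
  have h4 : ∀ i, |x i| ≤ B := by
    intro i
    have h5 := rr_ge x i
    have h6 : (x i)^2 ≤ (B:ℤ) := by
      have : (x i : ℝ)^2 ≤ B := by linarith
      exact_mod_cast this
    by_contra! hcon
    have : (|x i|)^2 ≤ (B:ℤ) := by rwa [sq_abs]
    nlinarith
  exact ⟨fun i => (abs_le.mp (h4 i)).1, fun i => (abs_le.mp (h4 i)).2⟩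

end

end Aux
namespace Aux

noncomputable section

variable {d : ℕ}

lemma refl (hd : 3 ≤ d) (σ : Zd d → Zd d) (hinv : ∀ x, σ (σ x) = x)
    (hcomm : ∀ (f : Zd d → ℝ) x, avg (fun y => f (σ y)) x = avg f (σ x)) (H : Set (Zd d))
    (h0 : ∀ x ∈ H, σ x ≠ 0)
    (hb : ∀ x ∈ H, ∀ i, (x + ee i ∉ H → σ (x + ee i) = x + ee i ∨ σ (x + ee i) = x) ∧
      (x - ee i ∉ H → σ (x - ee i) = x - ee i ∨ σ (x - ee i) = x)) :
    ∀ x ∈ H, G0 (σ x) ≤ G0 x := by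
  have key : ∀ x ∈ H, 0 ≤ G0 x - G0 (σ x) := by
    apply minP (by omega) (fun x => G0 x - G0 (σ x)) H
    · intro c hc
      have h1 := G0_decay hd (-c) (by linarith)
      have h2 : (σ ⁻¹' {x : Zd d | -c ≤ G0 x}).Finite :=
        h1.preimage (Function.Injective.injOn (fun a b h => by rw [← hinv a, h, hinv]))
      apply h2.subset
      rintro x ⟨_, hx⟩
      have := G0_nonneg x
      show -c ≤ G0 (σ x)
      linarith
    · intro x hx
      rw [avg_sub, hcomm, G0_harm hd _ (h0 x hx)]
      linarith [G0_super hd x]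
    · have gen : ∀ x y : Zd d, G0 x - G0 (σ x) < 0 → (σ y = y ∨ σ y = x) →
        G0 x - G0 (σ x) < G0 y - G0 (σ y) := by
        rintro x y hx (h | h)
        · rw [h]; linarith
        · have : y = σ x := by rw [← h, hinv]
          rw [h, this]; linarith
      intro x hx hneg i
      exact ⟨fun h => gen _ _ hneg ((hb x hx i).1 h), fun h => gen _ _ hneg ((hb x hx i).2 h)⟩
  intro x hx
  linarith [key x hx]

/-- coordinate reflection -/
def sc (j : Fin d) (c : ℤ) (x : Zd d) : Zd d := Function.update x j (c - x j)

lemma sc_inv (j : Fin d) (c : ℤ) (x : Zd d) : sc j c (sc j c x) = x := by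
  simp [sc]

lemma sc_comm (j : Fin d) (c : ℤ) (f : Zd d → ℝ) (x : Zd d) :
    avg (fun y => f (sc j c y)) x = avg f (sc j c x) := by
  unfold avg
  congr 1
  apply Finset.sum_congr rfl
  intro i _
  by_cases h : i = j
  · subst h
    rw [add_comm]
    congr 1 <;> refine congrArg f ?_ <;> ext k <;> by_cases hk : k = i
    all_goals first | (subst hk; simp [sc]; done) | (subst hk; simp [sc]; ring; done) | simp [sc, hk]
  · congr 1 <;> refine congrArg f ?_ <;> ext k <;> by_cases hk : k = j
    all_goals first | (subst hk; simp [sc, Ne.symm h]; done) | simp [sc, hk]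

/-- diagonal reflection -/
def sd (i j : Fin d) (c : ℤ) (x : Zd d) : Zd d :=
  fun k => if k = i then x j + c else if k = j then x i - c else x k

lemma sd_inv (i j : Fin d) (hij : i ≠ j) (c : ℤ) (x : Zd d) : sd i j c (sd i j c x) = x := by
  ext k
  simp only [sd]
  split_ifs <;> simp_all

lemma sd_comm (i j : Fin d) (hij : i ≠ j) (c : ℤ) (f : Zd d → ℝ) (x : Zd d) :
    avg (fun y => f (sd i j c y)) x = avg f (sd i j c x) := by
  unfold avg
  congr 1
  rw [← Equiv.sum_comp (Equiv.swap i j)]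
  apply Finset.sum_congr rfl
  intro k _
  have e : ∀ t : ℤ, ∀ l, sd i j c (x + t • ee (Equiv.swap i j k)) l = (sd i j c x + t • ee k) l := by
    intro t l
    simp only [sd, ee, Pi.add_apply, Pi.smul_apply, Pi.single_apply, Equiv.swap_apply_def]
    split_ifs <;> simp_all
    all_goals (try ring)
    all_goals grind
  have e1 := funext (e 1)
  have e2 := funext (e (-1))
  simp only [one_smul, neg_smul, ← sub_eq_add_neg] at e1 e2
  simp only [e1, e2]

lemma mono1 (hd : 3 ≤ d) (z : Zd d) (j : Fin d) (a : ℤ) (h : |z j| < a) :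
    G0 (Function.update z j a) ≤ G0 z := by
  obtain ⟨h1, h2⟩ := abs_lt.mp h
  have := refl hd (sc j (z j + a)) (sc_inv _ _) (sc_comm _ _) {x | 2 * x j < z j + a} ?_ ?_ z ?_
  · simpa [sc] using this
  · intro x hx h
    have := congrFun h j
    simp [sc] at this hx
    omega
  · intro x hx i
    simp only [Set.mem_ofPred_eq] at hx
    by_cases hi : i = j
    · subst hi
      constructor
      · intro hn
        simp at hn
        have : z i + a = 2 * x i + 2 ∨ z i + a = 2 * x i + 1 := by omega
        rcases this with h | h
        · left; ext k; by_cases hk : k = i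
          · subst hk; simp [sc]; omega
          · simp [sc, hk]
        · right; ext k; by_cases hk : k = i
          · subst hk; simp [sc]; omega
          · simp [sc, hk]
      · intro hn
        simp at hn
        omega
    · constructor
      · intro hn
        simp [Ne.symm hi] at hn
        omega
      · intro hn
        simp [Ne.symm hi] at hn
        omega
  · simp; omega

lemma mono2 (hd : 3 ≤ d) (z : Zd d) (j : Fin d) (a : ℤ) (h : |z j| < |a|) :
    G0 (Function.update z j a) ≤ G0 z := by
  rcases le_total 0 a with ha | ha
  · rw [abs_of_nonneg ha] at h
    exact mono1 hd z j a h
  · rw [abs_of_nonpos ha] at h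
    have := mono1 hd (-z) j (-a) (by simpa using h)
    rw [← G0_neg (Function.update z j a), ← G0_neg z]
    convert this using 2
    ext k
    by_cases hk : k = j
    · subst hk; simp
    · simp [hk]

lemma mono3 (hd : 3 ≤ d) (z b : Zd d) (h : ∀ i, |z i| < |b i| ∨ z i = b i) : G0 b ≤ G0 z := by
  have key : ∀ S : Finset (Fin d), G0 (S.piecewise b z) ≤ G0 z := by
    intro S
    induction S using Finset.induction_on with
    | empty => simp
    | insert j S hj ih =>
      rw [Finset.piecewise_insert]
      refine le_trans ?_ ih
      rcases h j with h | h
      · apply mono2 hd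
        rwa [Finset.piecewise_eq_of_notMem _ _ _ hj]
      · rw [← h, ← Finset.piecewise_eq_of_notMem S b z hj, Function.update_eq_self]
  simpa using key Finset.univ

lemma diag1 (hd : 3 ≤ d) (z : Zd d) (i j : Fin d) (hij : i ≠ j) (hi : 0 < z i) (hj : 0 < z j) :
    G0 (sd i j (z i) z) ≤ G0 z := by
  refine refl hd (sd i j (z i)) (sd_inv i j hij _) (sd_comm i j hij _) {x | x i - x j < z i} ?_ ?_ z ?_
  · intro x hx h
    have h1 := congrFun h i
    have h2 := congrFun h j
    simp [sd, hij.symm] at h1 h2 hx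
    omega
  · intro x hx k
    simp only [Set.mem_ofPred_eq] at hx
    constructor
    · intro hn
      left
      simp only [Set.mem_ofPred_eq, Pi.add_apply, ee, Pi.single_apply] at hn
      ext l
      simp only [sd, Pi.add_apply, ee, Pi.single_apply]
      grind
    · intro hn
      left
      simp only [Set.mem_ofPred_eq, Pi.sub_apply, ee, Pi.single_apply] at hn
      ext l
      simp only [sd, Pi.sub_apply, ee, Pi.single_apply]
      grind
  · simp; omega

lemma diag2 (hd : 3 ≤ d) (m : ℤ) (hm : 0 < m) (i : Fin d) :
    G0 (Pi.single i (d * m) : Zd d) ≤ G0 (fun _ => m : Zd d) := by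
  have key : ∀ S : Finset (Fin d), i ∉ S →
      G0 (fun k => if k = i then (S.card + 1) * m else if k ∈ S then 0 else m : Zd d) ≤
        G0 (fun _ => m : Zd d) := by
    intro S
    induction S using Finset.induction_on with
    | empty => intro _; simp
    | insert j S hj ih =>
      intro hi
      simp only [Finset.mem_insert, not_or] at hi
      refine le_trans (le_of_eq ?_) (le_trans (diag1 hd _ i j hi.1 ?_ ?_) (ih hi.2))
      · congr 1
        ext k
        simp only [sd, Finset.mem_insert]
        rw [Finset.card_insert_of_notMem hj]
        push_cast
        split_ifs <;> simp_all
        all_goals (try ring)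
      · simp; positivity
      · simp [hj, Ne.symm hi.1]; exact hm
  have := key (Finset.univ.erase i) (by simp)
  refine le_trans (le_of_eq ?_) this
  congr 1
  ext k
  rw [Finset.card_erase_of_mem (Finset.mem_univ _), Finset.card_univ, Fintype.card_fin]
  rw [Nat.cast_sub (by omega)]
  by_cases hk : k = i
  · subst hk; simp
  · simp [hk]

/-- comparison: points in a small box have larger Green function than distant points. -/
lemma compare (hd : 3 ≤ d) (m : ℤ) (hm : 0 < m) (z y : Zd d) (hz : ∀ i, |z i| < m) (i : Fin d)
    (hy : d * m ≤ |y i|) : G0 y ≤ G0 z := by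
  have h1 : G0 y ≤ G0 (Pi.single i (y i) : Zd d) := by
    apply mono3 hd
    intro j
    by_cases h : j = i
    · subst h; simp
    · simp [h]
      by_cases h0 : y j = 0
      · right; exact h0.symm
      · left; exact h0
  have h2 : G0 (Pi.single i (y i) : Zd d) ≤ G0 (Pi.single i (d * m) : Zd d) := by
    have hdm : 0 < (d : ℤ) * m := by positivity
    have h3 : G0 (Pi.single i (y i) : Zd d) = G0 (Pi.single i |y i| : Zd d) := by
      rcases abs_choice (y i) with h | h <;> rw [h]
      rw [Pi.single_neg, G0_neg]
    rw [h3]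
    apply mono3 hd
    intro j
    by_cases h : j = i
    · subst h
      simp only [Pi.single_eq_same, abs_abs, abs_of_pos hdm]
      exact lt_or_eq_of_le hy
    · simp [h]
  have h4 : G0 (fun _ => m : Zd d) ≤ G0 z := by
    apply mono3 hd
    intro j
    left
    rw [abs_of_pos hm]; exact hz j
  exact h1.trans (h2.trans ((diag2 hd m hm i).trans h4))

end

end Aux
namespace Aux

noncomputable section

variable {d : ℕ}

def sq2 (x : Zd d) : ℝ := ∑ i, (x i : ℝ)^2

lemma sq2_nonneg (x : Zd d) : 0 ≤ sq2 x := Finset.sum_nonneg fun _ _ => sq_nonneg _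

lemma sq2_ge (x : Zd d) (i : Fin d) : (x i : ℝ)^2 ≤ sq2 x :=
  Finset.single_le_sum (f := fun i => (x i : ℝ)^2) (fun _ _ => sq_nonneg _) (Finset.mem_univ i)

lemma sq2_fin (B : ℝ) : {x : Zd d | sq2 x ≤ B}.Finite := by
  obtain ⟨N, hN⟩ := exists_nat_ge B
  apply (Set.finite_Icc (fun _ : Fin d => -(N:ℤ)) (fun _ => (N:ℤ))).subset
  intro x hx
  have h4 : ∀ i, |x i| ≤ N := by
    intro i
    have h6 : (x i)^2 ≤ (N:ℤ) := by
      have : (x i : ℝ)^2 ≤ N := (sq2_ge x i).trans (le_trans hx hN)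
      exact_mod_cast this
    by_contra! hcon
    have : (|x i|)^2 ≤ (N:ℤ) := by rwa [sq_abs]
    nlinarith
  exact ⟨fun i => (abs_le.mp (h4 i)).1, fun i => (abs_le.mp (h4 i)).2⟩

lemma sq2_add (x : Zd d) (i : Fin d) : sq2 (x + ee i) = sq2 x + 1 + 2 * x i := by
  have := sq_sum_upd x i 1
  simp only [one_smul] at this
  unfold sq2; rw [this]; push_cast; ring

lemma sq2_sub (x : Zd d) (i : Fin d) : sq2 (x - ee i) = sq2 x + 1 - 2 * x i := by
  have := sq_sum_upd x i (-1)
  simp only [neg_smul, one_smul, ← sub_eq_add_neg] at this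
  unfold sq2; rw [this]; push_cast; ring

lemma cosh_ge (t : ℝ) : 2 + t^2 ≤ Real.exp t + Real.exp (-t) := by
  have key : ∀ s : ℝ, 0 ≤ s → 2 + s^2 ≤ Real.exp s + Real.exp (-s) := by
    intro s hs
    have h := Real.self_le_sinh_iff.mpr (by linarith : 0 ≤ s/2)
    have h2 := Real.cosh_two_mul (s/2)
    have h3 := Real.cosh_sq (s/2)
    rw [mul_div_cancel₀ _ (by norm_num : (2:ℝ) ≠ 0), Real.cosh_eq] at h2
    nlinarith
  rcases le_total 0 t with h | h
  · exact key t h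
  · have := key (-t) (by linarith)
    rw [neg_neg] at this
    nlinarith

lemma gauss_sub (hd : 3 ≤ d) (m : ℝ) (hm : d ≤ m) (x : Zd d) (hx : m^2 ≤ sq2 x) :
    Real.exp (-(d / m^2) * sq2 x) ≤ avg (fun y => Real.exp (-(d / m^2) * sq2 y)) x := by
  have hd' : (3:ℝ) ≤ d := by exact_mod_cast hd
  have hm0 : 0 < m := by linarith
  set β := d / m^2 with hβ
  have hβ0 : 0 < β := by positivity
  have hβm : β * m^2 = d := by rw [hβ]; field_simp
  have hβ1 : β ≤ 1 := by
    rw [hβ, div_le_one (by positivity)]; nlinarith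
  unfold avg
  rw [le_div_iff₀ (by positivity)]
  have e : ∀ i, Real.exp (-β * sq2 (x + ee i)) + Real.exp (-β * sq2 (x - ee i)) =
      Real.exp (-β * sq2 x) * Real.exp (-β) * (Real.exp (2 * β * x i) + Real.exp (-(2 * β * x i))) := by
    intro i
    rw [sq2_add, sq2_sub, ← Real.exp_add, mul_add (Real.exp _), ← Real.exp_add, ← Real.exp_add,
      add_comm]
    congr 1 <;> congr 1 <;> ring
  simp_rw [e]
  rw [← Finset.mul_sum, mul_assoc]
  apply mul_le_mul_of_nonneg_left _ (Real.exp_pos _).le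
  have h1 : (2:ℝ) * d * (1 + 2 * β) ≤ ∑ i, (Real.exp (2 * β * x i) + Real.exp (-(2 * β * x i))) := by
    refine le_trans ?_ (Finset.sum_le_sum fun i _ => cosh_ge (2 * β * x i))
    rw [Finset.sum_add_distrib]
    have : ∑ i, (2 * β * (x i : ℝ))^2 = 4 * β^2 * sq2 x := by
      unfold sq2; rw [Finset.mul_sum]; apply Finset.sum_congr rfl; intros; ring
    rw [this]
    simp only [Finset.sum_const, Finset.card_univ, Fintype.card_fin, nsmul_eq_mul]
    have : β * d ≤ β^2 * sq2 x := by
      calc β * d = β^2 * m^2 := by rw [← hβm]; ring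
        _ ≤ _ := by gcongr
    nlinarith
  have h2 : Real.exp β ≤ 1 + 2 * β := by
    have := Real.abs_exp_sub_one_sub_id_le (x := β) (by rw [abs_of_pos hβ0]; exact hβ1)
    have := (abs_le.mp this).2
    nlinarith
  have h3 : 2 * (d:ℝ) * Real.exp β ≤ ∑ i, (Real.exp (2 * β * x i) + Real.exp (-(2 * β * x i))) :=
    le_trans (by gcongr) h1
  calc 2 * (d:ℝ) = Real.exp (-β) * (2 * (d:ℝ) * Real.exp β) := by
        rw [Real.exp_neg]; field_simp
    _ ≤ _ := by gcongr

lemma gauss (hd : 3 ≤ d) (m : ℤ) (hm : d ≤ m) (a : ℝ) (ha0 : 0 ≤ a)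
    (ha : ∀ z : Zd d, (∀ i, |z i| < m) → a ≤ G0 z) (x : Zd d) :
    a * Real.exp (-(d / (m:ℝ)^2) * sq2 x) ≤ G0 x := by
  have hm' : (d:ℝ) ≤ m := by exact_mod_cast hm
  have hd' : (3:ℝ) ≤ d := by exact_mod_cast hd
  have hm0 : (0:ℝ) < m := by linarith
  have hmz : 0 < m := by exact_mod_cast hm0
  have hβ : 0 < d / (m:ℝ)^2 := by positivity
  have hin : ∀ y : Zd d, y ∉ {x : Zd d | (m:ℝ)^2 ≤ sq2 x} →
      0 ≤ G0 y - a * Real.exp (-(d / (m:ℝ)^2) * sq2 y) := by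
    intro y hy
    simp only [Set.mem_ofPred_eq, not_le] at hy
    have h1 : a ≤ G0 y := by
      apply ha
      intro i
      have : (y i : ℝ)^2 < (m:ℝ)^2 := lt_of_le_of_lt (sq2_ge y i) hy
      have : (y i)^2 < m^2 := by exact_mod_cast this
      have := sq_lt_sq.mp this
      rwa [abs_of_pos hmz] at this
    have h2 : Real.exp (-(d / (m:ℝ)^2) * sq2 y) ≤ 1 := by
      rw [Real.exp_le_one_iff]
      nlinarith [sq2_nonneg y]
    nlinarith [Real.exp_pos (-(d / (m:ℝ)^2) * sq2 y)]
  have key := minP (by omega) (fun y => G0 y - a * Real.exp (-(d / (m:ℝ)^2) * sq2 y))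
    {x : Zd d | (m:ℝ)^2 ≤ sq2 x} ?_ ?_ ?_
  · by_cases h : x ∈ {x : Zd d | (m:ℝ)^2 ≤ sq2 x}
    · linarith [key x h]
    · linarith [hin x h]
  · intro c hc
    apply (sq2_fin (d := d) ((a / (-c)) / (d / (m:ℝ)^2))).subset
    rintro y ⟨_, hy⟩
    have h1 : -c ≤ a * Real.exp (-(d / (m:ℝ)^2) * sq2 y) := by linarith [G0_nonneg y]
    show sq2 y ≤ _
    rw [le_div_iff₀ hβ, le_div_iff₀ (by linarith)]
    rw [neg_mul, Real.exp_neg, ← div_eq_mul_inv, le_div_iff₀ (Real.exp_pos _)] at h1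
    have h2 := Real.add_one_le_exp (d / (m:ℝ)^2 * sq2 y)
    nlinarith
  · intro y hy
    rw [avg_sub, avg_mul]
    have := gauss_sub hd m hm' y hy
    have := mul_le_mul_of_nonneg_left this ha0
    linarith [G0_super hd y]
  · intro y hy hneg i
    exact ⟨fun h => lt_of_lt_of_le hneg (hin _ h), fun h => lt_of_lt_of_le hneg (hin _ h)⟩

lemma harnack (hd : 3 ≤ d) (k : ℤ) (hk : 2 * d * d ≤ k) (x y : Zd d) (hx : ∀ i, |x i| ≤ k)
    (i : Fin d) (hy : k ≤ 2 * |y i|) : G0 y ≤ Real.exp (16 * d^4) * G0 x := by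
  have hdz : (3:ℤ) ≤ d := by exact_mod_cast hd
  have hd' : (3:ℝ) ≤ d := by exact_mod_cast hd
  obtain ⟨m, hm⟩ : ∃ m : ℤ, m = k / (2 * d) := ⟨_, rfl⟩
  have h2d : (0:ℤ) < 2 * d := by linarith
  have m1 : m * (2 * d) ≤ k := by rw [hm]; exact Int.ediv_mul_le _ h2d.ne'
  have m2 : k < (m + 1) * (2 * d) := by rw [hm]; exact Int.lt_ediv_add_one_mul_self _ h2d
  have m3 : (d:ℤ) ≤ m := by rw [hm, Int.le_ediv_iff_mul_le h2d]; linarith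
  have hm0 : 0 < m := by linarith
  have hg := gauss hd m m3 (G0 y) (G0_nonneg y) (fun z hz => compare hd m hm0 z y hz i (by nlinarith)) x
  have hsq : sq2 x ≤ d * (k:ℝ)^2 := by
    unfold sq2
    refine (Finset.sum_le_sum (g := fun _ => (k:ℝ)^2) fun j _ => ?_).trans (by simp)
    have : |(x j : ℝ)| ≤ k := by exact_mod_cast hx j
    exact sq_le_sq' (abs_le.mp this).1 (abs_le.mp this).2
  have hkm : (k:ℝ) ≤ 4 * d * m := by
    have : k ≤ 4 * d * m := by nlinarith
    exact_mod_cast this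
  have hmr : (0:ℝ) < m := by exact_mod_cast hm0
  have hk0 : (0:ℝ) ≤ k := by
    have : 0 ≤ k := by nlinarith
    exact_mod_cast this
  have hexp : (d / (m:ℝ)^2) * sq2 x ≤ 16 * d^4 := by
    rw [div_mul_eq_mul_div, div_le_iff₀ (by positivity)]
    calc (d:ℝ) * sq2 x ≤ d * (d * (k:ℝ)^2) := by gcongr
      _ ≤ d * (d * (4 * d * m)^2) := by gcongr
      _ = _ := by ring
  calc G0 y = Real.exp (16 * d^4) * (G0 y * Real.exp (-(16 * d^4))) := by
        rw [Real.exp_neg]; field_simp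
    _ ≤ Real.exp (16 * d^4) * (G0 y * Real.exp (-(d / (m:ℝ)^2) * sq2 x)) := by
        have := G0_nonneg y
        gcongr
        linarith
    _ ≤ _ := by gcongr

/-- gradient estimate for harmonic functions -/
lemma grad (hd : 3 ≤ d) (R : ℤ) (hR : 2 ≤ R) (M : ℝ) (hM0 : 0 ≤ M) (u : Zd d → ℝ) (x : Zd d) (j : Fin d)
    (hu : ∀ y, (∀ i, |y i - x i| ≤ R) → 0 ≤ u y ∧ u y ≤ M)
    (hh : ∀ y, (∀ i, |y i - x i| ≤ R) → avg u y = u y) :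
    u (x + ee j) - u x ≤ M * d / R := by
  have hd' : (3:ℝ) ≤ d := by exact_mod_cast hd
  have hRr : (2:ℝ) ≤ R := by exact_mod_cast hR
  have hR0 : (0:ℝ) < R := by linarith
  set σ : Zd d → Zd d := sc j (2 * x j + 1) with hσ
  let b : Zd d → ℝ := fun y => M / R^2 * (d * R * (y j - x j) - d * ((y j : ℝ) - x j)^2 + sq2 (y - x))
  let H : Set (Zd d) := {y | 1 ≤ y j - x j ∧ ∀ i, |y i - x i| ≤ R - 1}
  have hσR : ∀ y : Zd d, 0 ≤ y j - x j → (∀ i, |y i - x i| ≤ R) → ∀ i, |σ y i - x i| ≤ R := by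
    intro y h0 h i
    by_cases hi : i = j
    · subst hi
      have := h i
      rw [abs_le] at this ⊢
      simp only [hσ, sc, Function.update_self]
      omega
    · simp only [hσ, sc, Function.update_of_ne hi]; exact h i
  have hb0 : ∀ y : Zd d, 0 ≤ y j - x j → y j - x j ≤ R → 0 ≤ b y := by
    intro y h1 h2
    have h1' : (0:ℝ) ≤ y j - x j := by exact_mod_cast h1
    have h2' : (y j:ℝ) - x j ≤ R := by exact_mod_cast h2
    apply mul_nonneg (by positivity)
    have := sq2_nonneg (y - x)
    nlinarith [mul_nonneg h1' (sub_nonneg.mpr h2')]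
  have hbM : ∀ y : Zd d, 0 ≤ y j - x j → y j - x j ≤ R → (∃ i, (|y i - x i| = R)) → M ≤ b y := by
    rintro y h1 h2 ⟨i, hi⟩
    have h1' : (0:ℝ) ≤ y j - x j := by exact_mod_cast h1
    have h2' : (y j:ℝ) - x j ≤ R := by exact_mod_cast h2
    have h3 := sq2_ge (y - x) i
    have h4 : (((y - x) i : ℤ) : ℝ)^2 = R^2 := by
      have : ((y - x) i)^2 = R^2 := by rw [← hi, sq_abs]; rfl
      exact_mod_cast this
    rw [h4] at h3
    have : M = M / R^2 * R^2 := by field_simp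
    rw [this]
    apply mul_le_mul_of_nonneg_left _ (by positivity)
    nlinarith [mul_nonneg h1' (sub_nonneg.mpr h2')]
  have hbh : ∀ y, avg b y = b y := by
    intro y
    have hdpos : (0:ℝ) < 2 * d := by positivity
    unfold avg
    rw [div_eq_iff hdpos.ne']
    have e : ∀ i, b (y + ee i) + b (y - ee i) =
        2 * b y + M / R^2 * (2 - if i = j then 2 * (d:ℝ) else 0) := by
      intro i
      have e1 : y + ee i - x = (y - x) + ee i := by abel
      have e2 : y - ee i - x = (y - x) - ee i := by abel
      simp only [b]
      rw [e1, e2, sq2_add, sq2_sub]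
      by_cases h : i = j
      · subst h
        simp
        ring
      · simp [h, Ne.symm h]
        ring
    simp_rw [e]
    generalize b y = B
    rw [Finset.sum_add_distrib, ← Finset.mul_sum, ← Finset.mul_sum, Finset.sum_sub_distrib]
    simp
    ring
  have key := minP (by omega) (fun y => b y - (u y - u (σ y))) H ?_ ?_ ?_ (x + ee j) ?_
  · have h1 : σ (x + ee j) = x := by
      ext k
      by_cases hk : k = j
      · subst hk; simp [hσ, sc]; ring
      · simp [hσ, sc, hk]
    have h2 : b (x + ee j) ≤ M * d / R := by
      have e1 : x + ee j - x = 0 + ee j := by abel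
      simp only [b]
      rw [e1, sq2_add]
      simp [sq2]
      rw [div_mul_eq_mul_div, div_le_div_iff₀ (by positivity) hR0]
      have : M * (d * R + -d + 1) * R ≤ M * (d * R) * R := by gcongr; linarith
      nlinarith
    rw [h1] at key
    linarith
  · intro c _
    apply (Set.finite_Icc (fun i => x i - R) (fun i => x i + R)).subset
    rintro y ⟨⟨_, hy⟩, _⟩
    refine ⟨fun i => ?_, fun i => ?_⟩ <;> (have := abs_le.mp (hy i); simp only; omega)
  · rintro y ⟨h1, h2⟩
    have h3 : ∀ i, |y i - x i| ≤ R := fun i => (h2 i).trans (by omega)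
    rw [avg_sub, avg_sub, hbh, sc_comm, hh y h3, hh _ (hσR y (by omega) h3)]
  · rintro y ⟨h1, h2⟩ hneg i
    have gen : ∀ w : Zd d, (∀ k, |w k - y k| ≤ 1) → (w j - y j = 0 ∨ ∀ k ≠ j, w k = y k) → w ∉ H →
        b y - (u y - u (σ y)) < b w - (u w - u (σ w)) := by
      intro w hw hwj hwH
      have hwR : ∀ k, |w k - x k| ≤ R := by
        intro k
        have a1 := abs_le.mp (hw k)
        have a2 := abs_le.mp (h2 k)
        rw [abs_le]; omega
      have hw0 : 0 ≤ w j - x j := by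
        have a1 := abs_le.mp (hw j)
        omega
      have hwR' : w j - x j ≤ R := (abs_le.mp (hwR j)).2
      by_cases hfar : ∃ k, |w k - x k| = R
      · have a1 := hbM w hw0 hwR' hfar
        have a2 := hu w hwR
        have a3 := hu (σ w) (hσR w hw0 hwR)
        linarith
      · push Not at hfar
        have hj0 : w j - x j = 0 := by
          by_contra hne
          apply hwH
          refine ⟨by omega, fun k => ?_⟩
          have := lt_of_le_of_ne (hwR k) (hfar k)
          omega
        have hσw : σ w = y := by
          have hk : ∀ k ≠ j, w k = y k := by
            rcases hwj with h | h
            · omega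
            · exact h
          ext k
          by_cases hkj : k = j
          · subst hkj
            have a1 := abs_le.mp (hw k)
            simp [hσ, sc]; omega
          · simp [hσ, sc, hkj, hk k hkj]
        have hσy : σ y = w := by rw [← hσw, hσ, sc_inv]
        rw [hσy] at hneg
        rw [hσw, hσy]
        have a1 := hb0 w hw0 hwR'
        have a2 := hb0 y (by omega) ((abs_le.mp (h2 j)).2.trans (by omega))
        linarith
    constructor
    · apply gen
      · intro k; by_cases h : k = i
        · subst h; simp
        · simp [h]
      · by_cases h : j = i
        · right; intro k hk; simp [← h, hk]
        · left; simp [h]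
    · apply gen
      · intro k; by_cases h : k = i
        · subst h; simp
        · simp [h]
      · by_cases h : j = i
        · right; intro k hk; simp [← h, hk]
        · left; simp [h]
  · refine ⟨by simp, fun i => ?_⟩
    by_cases h : i = j
    · subst h; simp; omega
    · simp [h]; omega

end

end Aux
namespace Aux

noncomputable section

variable {d : ℕ}

def Cst (d : ℕ) : ℝ := 3 * d * Real.exp (16 * d^4)

lemma Cst_nonneg (d : ℕ) : 0 ≤ Cst d := by unfold Cst; positivity

lemma step_add (hd : 3 ≤ d) (N : ℤ) (hN : 2 * d * d ≤ N) (x : Zd d) (hx : ∃ i, N ≤ |x i|) (j : Fin d) :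
    G0 (x + ee j) ≤ (1 + Cst d / N) * G0 x := by
  have hdz : (3:ℤ) ≤ d := by exact_mod_cast hd
  obtain ⟨i1, h1⟩ := hx
  obtain ⟨i0, -, h0⟩ := Finset.exists_max_image Finset.univ (fun i => |x i|) ⟨i1, Finset.mem_univ _⟩
  set k := |x i0| with hk
  have hNk : N ≤ k := h1.trans (h0 i1 (Finset.mem_univ _))
  have hN18 : 18 ≤ N := by nlinarith
  obtain ⟨R, hR⟩ : ∃ R : ℤ, R = k / 2 := ⟨_, rfl⟩
  have hfar : ∀ y : Zd d, (∀ i, |y i - x i| ≤ R) → k ≤ 2 * |y i0| := by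
    intro y hy
    have := hy i0
    have h3 : |x i0| ≤ |y i0| + |y i0 - x i0| := by
      have := abs_sub_abs_le_abs_sub (x i0) (y i0)
      rw [abs_sub_comm] at this
      linarith
    omega
  have hg := grad hd R (by omega) (Real.exp (16 * d^4) * G0 x)
    (mul_nonneg (Real.exp_pos _).le (G0_nonneg x)) G0 x j ?_ ?_
  · have hRk : (N:ℝ) ≤ 3 * R := by
      have : N ≤ 3 * R := by omega
      exact_mod_cast this
    have hNr : (0:ℝ) < N := by
      have : 0 < N := by omega
      exact_mod_cast this
    have hRr : (0:ℝ) < R := by linarith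
    have : Real.exp (16 * d^4) * G0 x * d / R ≤ Cst d / N * G0 x := by
      rw [div_mul_eq_mul_div, div_le_div_iff₀ hRr hNr]
      unfold Cst
      have : Real.exp (16 * d^4) * G0 x * d * N ≤ Real.exp (16 * d^4) * G0 x * d * (3 * R) := by
        have := G0_nonneg x
        gcongr
      linarith
    linarith
  · intro y hy
    exact ⟨G0_nonneg y, harnack hd k (by linarith) x y (fun i => h0 i (Finset.mem_univ _)) i0 (hfar y hy)⟩
  · intro y hy
    apply G0_harm hd
    intro h
    have := hfar y hy
    rw [h] at this
    simp at this
    omega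

lemma step_sub (hd : 3 ≤ d) (N : ℤ) (hN : 2 * d * d ≤ N) (x : Zd d) (hx : ∃ i, N ≤ |x i|) (j : Fin d) :
    G0 (x - ee j) ≤ (1 + Cst d / N) * G0 x := by
  have := step_add hd N hN (-x) (by simpa using hx) j
  rw [G0_neg, ← G0_neg (-x + ee j)] at this
  convert this using 2
  abel

lemma ratio (hd : 3 ≤ d) (N : ℤ) (hN : 2 * d * d ≤ N) (n : ℕ) : ∀ (x x' : Zd d),
    (∑ i, (x' i - x i).natAbs) = n → (∃ i, N + n ≤ |x i|) →
    G0 x' ≤ (1 + Cst d / N)^n * G0 x := by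
  have hdz : (3:ℤ) ≤ d := by exact_mod_cast hd
  have hNr : (0:ℝ) ≤ N := by
    have : 0 ≤ N := by nlinarith
    exact_mod_cast this
  have hc : 0 ≤ 1 + Cst d / N := by have := Cst_nonneg d; positivity
  induction n with
  | zero =>
    intro x x' h _
    have : x' = x := by
      ext i
      have := (Finset.sum_eq_zero_iff.mp h) i (Finset.mem_univ _)
      omega
    simp [this]
  | succ n ih =>
    intro x x' h hx
    obtain ⟨j, hj⟩ : ∃ j, x' j ≠ x j := by
      by_contra! hcon
      simp [hcon] at h
    obtain ⟨i1, h1⟩ := hx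
    have gen : ∀ w : Zd d, (w = x + ee j ∧ x j < x' j ∨ w = x - ee j ∧ x' j < x j) →
        G0 w ≤ (1 + Cst d / N) * G0 x → G0 x' ≤ (1 + Cst d / N)^(n+1) * G0 x := by
      intro w hw hG
      have hwk : ∀ k, k ≠ j → w k = x k := by
        intro k hk
        rcases hw with h | h <;> simp [h.1, hk]
      have hsum : (∑ i, (x' i - w i).natAbs) = n := by
        rw [← Finset.add_sum_erase _ _ (Finset.mem_univ j)] at h ⊢
        have e : ∑ i ∈ Finset.univ.erase j, (x' i - w i).natAbs =
            ∑ i ∈ Finset.univ.erase j, (x' i - x i).natAbs := by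
          apply Finset.sum_congr rfl
          intro k hk
          rw [hwk k (Finset.ne_of_mem_erase hk)]
        rw [e]
        rcases hw with h | h <;> (simp [h.1]; omega)
      have hw1 : N + n ≤ |w i1| := by
        by_cases hi : i1 = j
        · subst hi
          rcases hw with h | h
          · simp [h.1]; push_cast at h1; grind
          · simp [h.1]; push_cast at h1; grind
        · rw [hwk _ hi]; push_cast at h1; omega
      calc G0 x' ≤ (1 + Cst d / N)^n * G0 w := ih w x' hsum ⟨i1, hw1⟩
        _ ≤ (1 + Cst d / N)^n * ((1 + Cst d / N) * G0 x) := by gcongr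
        _ = _ := by ring
    have hx' : ∃ i, N ≤ |x i| := ⟨i1, by push_cast at h1; omega⟩
    rcases lt_or_gt_of_ne hj with h | h
    · exact gen _ (Or.inr ⟨rfl, h⟩) (step_sub hd N hN x hx' j)
    · exact gen _ (Or.inl ⟨rfl, h⟩) (step_add hd N hN x hx' j)

/-- final Harnack comparison. -/
lemma ratio_final (hd : 3 ≤ d) (ε : ℝ) (hε : 0 < ε) : ∃ c : ℝ, ∀ (L K : ℕ), 1 ≤ L → c ≤ (K:ℝ) →
    100 ≤ K → ∀ x x' : Zd d, (∀ i, |x' i - x i| ≤ 14 * L) → (∃ i, (2 * K - 4) * (L:ℤ) ≤ |x i|) →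
    G0 x' ≤ (1 + ε) * G0 x := by
  have hlog : 0 < Real.log (1 + ε) := Real.log_pos (by linarith)
  refine ⟨max (max (14 * d + 4) (2 * d * d)) (Cst d * (14 * d) / Real.log (1 + ε)), ?_⟩
  intro L K hL hK hK100 x x' hxx' ⟨i, hi⟩
  have k1 : (14 * d + 4 : ℝ) ≤ K := (le_max_left _ _).trans ((le_max_left _ _).trans hK)
  have k2 : (2 * d * d : ℝ) ≤ K := (le_max_right _ _).trans ((le_max_left _ _).trans hK)
  have k3 : Cst d * (14 * d) / Real.log (1 + ε) ≤ K := (le_max_right _ _).trans hK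
  have k1' : (14 * d + 4 : ℤ) ≤ K := by exact_mod_cast k1
  have k2' : (2 * d * d : ℤ) ≤ K := by exact_mod_cast k2
  have hLz : (1:ℤ) ≤ L := by exact_mod_cast hL
  set n := ∑ i, (x' i - x i).natAbs with hn
  have hnle : n ≤ d * (14 * L) := by
    rw [hn]
    refine (Finset.sum_le_sum (g := fun _ => 14 * L) fun j _ => ?_).trans (by simp)
    have := hxx' j
    rw [Int.abs_eq_natAbs] at this
    omega
  have hnle' : (n:ℤ) ≤ d * (14 * L) := by exact_mod_cast hnle
  have h := ratio hd (K * L) (by nlinarith) n x x' hn.symm ⟨i, by nlinarith⟩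
  refine h.trans ?_
  apply mul_le_mul_of_nonneg_right _ (G0_nonneg x)
  have hKr : (0:ℝ) < K := by
    have : (100:ℝ) ≤ K := by exact_mod_cast hK100
    linarith
  have hLr : (0:ℝ) < L := by
    have : (1:ℝ) ≤ L := by exact_mod_cast hL
    linarith
  have hC := Cst_nonneg d
  push_cast
  calc (1 + Cst d / (K * L))^n ≤ (Real.exp (Cst d / (K * L)))^n := by
        gcongr
        rw [add_comm]
        exact Real.add_one_le_exp _
    _ = Real.exp (n * (Cst d / (K * L))) := by rw [← Real.exp_nat_mul]
    _ ≤ Real.exp (Real.log (1 + ε)) := by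
        apply Real.exp_le_exp.mpr
        rw [div_le_iff₀ hlog] at k3
        rw [mul_div_assoc', div_le_iff₀ (by positivity)]
        have hnr : (n:ℝ) ≤ d * (14 * L) := by exact_mod_cast hnle
        calc (n:ℝ) * Cst d ≤ d * (14 * L) * Cst d := by gcongr
          _ = Cst d * (14 * d) * L := by ring
          _ ≤ K * Real.log (1 + ε) * L := by gcongr
          _ = _ := by ring
    _ = 1 + ε := Real.exp_log (by linarith)

end

end Aux
namespace Aux

noncomputable section

variable {d : ℕ} {Ω : Type*} [MeasurableSpace Ω]

/-! exponential measure -/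

lemma exp_apply (I : Set ℝ) (hI : MeasurableSet I) :
    expMeasure I = ∫⁻ t in I ∩ Set.Ioi 0, ENNReal.ofReal (Real.exp (-t)) := by
  unfold expMeasure
  rw [withDensity_apply _ hI, ← lintegral_indicator hI,
    ← lintegral_indicator (hI.inter measurableSet_Ioi)]
  congr 1
  ext t
  by_cases h1 : t ∈ I <;> by_cases h2 : 0 < t <;> simp [h1, h2, Set.indicator]

lemma exp_univ : expMeasure Set.univ = 1 := by
  rw [exp_apply _ MeasurableSet.univ, Set.univ_inter, ← ofReal_integral_eq_lintegral_ofReal,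
    integral_exp_neg_Ioi_zero, ENNReal.ofReal_one]
  · exact integrableOn_exp_neg_Ioi 0
  · exact Filter.Eventually.of_forall fun t => (Real.exp_pos _).le

instance : IsProbabilityMeasure expMeasure := ⟨exp_univ⟩

lemma exp_Iic : expMeasure (Set.Iic 0) = 0 := by
  rw [exp_apply _ measurableSet_Iic]
  have : Set.Iic (0:ℝ) ∩ Set.Ioi 0 = ∅ := by ext t; simp
  rw [this]; simp

lemma exp_Iio_one : expMeasure (Set.Iio 1) < 1 := by
  have h : expMeasure (Set.Ici 1) ≠ 0 := by
    rw [exp_apply _ measurableSet_Ici]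
    have : Set.Ici (1:ℝ) ∩ Set.Ioi 0 = Set.Ici 1 := by
      ext t; simp; intro h; linarith
    rw [this]
    intro h0
    rw [lintegral_eq_zero_iff (by fun_prop)] at h0
    have h1 : (volume.restrict (Set.Ici (1:ℝ))) Set.univ = 0 := by
      rw [Filter.EventuallyEq, ae_iff] at h0
      rw [← h0]
      congr 1
      ext t; simp [Real.exp_pos]
    simp at h1
  have h2 := prob_add_prob_compl (μ := expMeasure) (measurableSet_Iio (a := (1:ℝ)))
  rw [Set.compl_Iio] at h2
  rw [← h2]
  exact ENNReal.lt_add_right (measure_ne_top _ _) h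

lemma exp_mean : ∫⁻ t, ENNReal.ofReal t ∂expMeasure = 1 := by
  unfold expMeasure
  rw [lintegral_withDensity_eq_lintegral_mul _ (by
    apply Measurable.ennreal_ofReal
    exact Measurable.ite measurableSet_Ioi (by fun_prop) measurable_const) (by fun_prop)]
  have : ∀ t : ℝ, ((fun t => ENNReal.ofReal (if 0 < t then Real.exp (-t) else 0)) * fun t => ENNReal.ofReal t) t
      = (Set.Ioi (0:ℝ)).indicator (fun t => ENNReal.ofReal (Real.exp (-t) * t)) t := by
    intro t
    by_cases h : 0 < t
    · simp [h, ENNReal.ofReal_mul (Real.exp_pos _).le]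
    · simp [h]
  rw [lintegral_congr this, lintegral_indicator measurableSet_Ioi]
  have hg := Real.GammaIntegral_convergent (s := 2) (by norm_num)
  have hG := Real.Gamma_eq_integral (s := 2) (by norm_num)
  have e : ∀ t : ℝ, Real.exp (-t) * t ^ ((2:ℝ) - 1) = Real.exp (-t) * t := by
    intro t; norm_num
  simp_rw [e] at hg hG
  rw [← ofReal_integral_eq_lintegral_ofReal hg, ← hG]
  · rw [Real.Gamma_two, ENNReal.ofReal_one]
  · filter_upwards [ae_restrict_mem measurableSet_Ioi] with t ht
    exact mul_nonneg (Real.exp_pos _).le (le_of_lt ht)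

/-! step distribution -/

lemma stepP_eq (v : Zd d) : stepP d v =
    ∑ i, ((if v = ee i then ((2 * d : ℕ) : ℝ≥0∞)⁻¹ else 0) + (if v = -ee i then ((2 * d : ℕ) : ℝ≥0∞)⁻¹ else 0)) := by
  have hsum : ∀ i : Fin d, ∑ k, (ee i k).natAbs = 1 := by
    intro i
    rw [Finset.sum_eq_single i]
    · simp
    · intro b _ hb; simp [hb]
    · simp
  unfold stepP
  split_ifs with h
  · obtain ⟨i, hi⟩ : ∃ i, v i ≠ 0 := by
      by_contra! hcon
      simp [hcon] at h
    rw [← Finset.add_sum_erase _ _ (Finset.mem_univ i)] at h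
    have h1 : (v i).natAbs = 1 := by omega
    have h2 : ∑ k ∈ Finset.univ.erase i, (v k).natAbs = 0 := by omega
    have h3 : ∀ k, k ≠ i → v k = 0 := by
      intro k hk
      have := (Finset.sum_eq_zero_iff.mp h2) k (Finset.mem_erase.mpr ⟨hk, Finset.mem_univ _⟩)
      omega
    rw [Finset.sum_eq_single i]
    · rcases Int.natAbs_eq (v i) with h4 | h4
      · rw [h1] at h4
        have e1 : v = ee i := by
          ext k; by_cases hk : k = i
          · subst hk; simp [h4]
          · simp [hk, h3 k hk]
        have e2 : v ≠ -ee i := by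
          intro hc; have := congrFun hc i; simp [h4] at this
        rw [if_pos e1, if_neg e2, add_zero]
      · rw [h1] at h4
        have e1 : v = -ee i := by
          ext k; by_cases hk : k = i
          · subst hk; simp [h4]
          · simp [hk, h3 k hk]
        have e2 : v ≠ ee i := by
          intro hc; have := congrFun hc i; simp [h4] at this
        rw [if_pos e1, if_neg e2, zero_add]
    · intro b _ hb
      have e1 : v ≠ ee b := by
        intro hc; have := congrFun hc i; simp [Ne.symm hb] at this; exact hi this
      have e2 : v ≠ -ee b := by
        intro hc; have := congrFun hc i; simp [Ne.symm hb] at this; exact hi this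
      rw [if_neg e1, if_neg e2, add_zero]
    · simp
  · symm
    apply Finset.sum_eq_zero
    intro i _
    have e1 : v ≠ ee i := by
      intro hc; apply h; rw [hc]; exact hsum i
    have e2 : v ≠ -ee i := by
      intro hc; apply h; rw [hc]; simpa using hsum i
    rw [if_neg e1, if_neg e2, add_zero]

lemma tsum_step (f : Zd d → ℝ≥0∞) (w : Zd d) : ∑' a, f a * stepP d (w - a) =
    (∑ i, (f (w + ee i) + f (w - ee i))) * ((2 * d : ℕ) : ℝ≥0∞)⁻¹ := by
  simp_rw [stepP_eq, Finset.mul_sum]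
  rw [Summable.tsum_finsetSum (fun _ _ => ENNReal.summable), Finset.sum_mul]
  apply Finset.sum_congr rfl
  intro i _
  simp_rw [mul_add]
  rw [ENNReal.tsum_add, add_mul, add_comm]
  congr 1
  · rw [tsum_eq_single (w + ee i)]
    · simp
    · intro b hb
      rw [if_neg, mul_zero]
      intro hc; apply hb
      rw [sub_eq_iff_eq_add] at hc; rw [hc]; abel
  · rw [tsum_eq_single (w - ee i)]
    · simp
    · intro b hb
      rw [if_neg, mul_zero]
      intro hc; apply hb
      rw [sub_eq_iff_eq_add] at hc; rw [hc]; abel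

end

end Aux
namespace Aux

noncomputable section

variable {d : ℕ} {Ω : Type*} [MeasurableSpace Ω] (W : SRW d Ω)

lemma hY0 (x : Zd d) : ∀ᵐ ω ∂(W.P x), W.Y 0 ω = x := by
  have := W.isProb x
  have hm : MeasurableSet {ω | W.Y 0 ω = x} := W.measurable_Y 0 (MeasurableSet.of_discrete (s := {x}))
  exact (prob_compl_eq_zero_iff hm).2 (W.Y_zero x)

lemma path (x : Zd d) (n : ℕ) (y : Fin (n+1) → Zd d) (I : Fin n → Set ℝ)
    (hI : ∀ i, MeasurableSet (I i)) :
    W.P x {ω | (∀ k : Fin (n+1), W.Y k ω = y k) ∧ ∀ i : Fin n, W.ζ i ω ∈ I i}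
      = if y 0 = x then (∏ i : Fin n, stepP d (y i.succ - y i.castSucc)) *
          ∏ i, expMeasure (I i) else 0 := by
  split_ifs with h
  · rw [← W.law x n (fun i => y i.succ - y i.castSucc) I hI]
    apply measure_congr
    filter_upwards [hY0 W x] with ω hω
    apply propext
    refine and_congr_left fun _ => ?_
    constructor
    · intro hk i
      have h1 := hk i.succ
      have h2 := hk i.castSucc
      simp only [Fin.val_succ, Fin.val_castSucc] at h1 h2
      rw [h1, h2]
    · intro hs k
      induction k using Fin.induction with
      | zero => simp [hω, h]
      | succ i ih =>
        have := hs i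
        simp only [Fin.val_castSucc] at ih
        rw [ih] at this
        simpa using this
  · refine measure_mono_null ?_ (hY0 W x)
    rintro ω ⟨h1, -⟩ h2
    exact h (by rw [← h1 0]; simpa using h2)

lemma path_step (x : Zd d) (n : ℕ) (y : Fin (n+1) → Zd d) (w : Zd d) (I : Set ℝ)
    (hI : MeasurableSet I) :
    W.P x {ω | (∀ k : Fin (n+1), W.Y k ω = y k) ∧ W.Y (n+1) ω = w ∧ W.ζ n ω ∈ I}
      = W.P x {ω | ∀ k : Fin (n+1), W.Y k ω = y k} *
        (stepP d (w - y (Fin.last n)) * expMeasure I) := by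
  have h1 := path W x n y (fun _ => univ) (fun _ => MeasurableSet.univ)
  have h2 := path W x (n+1) (Fin.snoc y w) (Fin.snoc (fun _ => univ) I) (by
    intro i
    induction i using Fin.lastCases with
    | last => simpa using hI
    | cast i => simp)
  have e1 : {ω | (∀ k : Fin (n+1), W.Y k ω = y k) ∧ ∀ i : Fin n, W.ζ i ω ∈ (univ : Set ℝ)}
    = {ω | ∀ k : Fin (n+1), W.Y k ω = y k} := by ext; simp
  have e2 : {ω | (∀ k : Fin (n+1+1), W.Y k ω = (Fin.snoc y w : Fin (n+1+1) → Zd d) k) ∧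
      ∀ i : Fin (n+1), W.ζ i ω ∈ (Fin.snoc (fun _ => univ) I : Fin (n+1) → Set ℝ) i}
    = {ω | (∀ k : Fin (n+1), W.Y k ω = y k) ∧ W.Y (n+1) ω = w ∧ W.ζ n ω ∈ I} := by
    ext ω
    simp [Fin.forall_fin_succ' (n := n+1), Fin.forall_fin_succ' (n := n), and_assoc]
  rw [e1] at h1
  rw [e2] at h2
  rw [h1, h2]
  have h0 : (Fin.snoc y w : Fin (n+1+1) → Zd d) 0 = y 0 := by
    rw [← Fin.castSucc_zero, Fin.snoc_castSucc]
  rw [h0]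
  split_ifs
  · rw [Fin.prod_univ_castSucc (n := n), Fin.prod_univ_castSucc (n := n)]
    simp only [Fin.snoc_last, Fin.snoc_castSucc, Fin.succ_last, exp_univ, Finset.prod_const_one,
      one_mul, mul_one, ← Fin.castSucc_succ]
    rw [mul_assoc]
  · simp

lemma meas_Y (n : ℕ) (T : Set (Zd d)) : MeasurableSet {ω | W.Y n ω ∈ T} :=
  W.measurable_Y n (MeasurableSet.of_discrete (s := T))

lemma meas_Yeq (n : ℕ) (a : Zd d) : MeasurableSet {ω | W.Y n ω = a} :=
  meas_Y W n {a}

lemma meas_path (n : ℕ) (y : Fin (n+1) → Zd d) :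
    MeasurableSet {ω | ∀ k : Fin (n+1), W.Y k ω = y k} := by
  rw [Set.ofPred_forall]
  exact MeasurableSet.iInter fun k => meas_Yeq W k _

def extn (n : ℕ) (y : Fin (n+1) → Zd d) (k : ℕ) : Zd d := if h : k < n+1 then y ⟨k, h⟩ else 0

lemma decomp (x : Zd d) (n : ℕ) (Φ : (ℕ → Zd d) → Prop)
    (hΦ : ∀ f g : ℕ → Zd d, (∀ k ≤ n, f k = g k) → Φ f → Φ g) (B : Set Ω) (hB : MeasurableSet B) :
    W.P x {ω | Φ (fun k => W.Y k ω) ∧ ω ∈ B} =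
      ∑' y : {y : Fin (n+1) → Zd d // Φ (extn n y)},
        W.P x {ω | (∀ k : Fin (n+1), W.Y k ω = y.1 k) ∧ ω ∈ B} := by
  rw [← measure_iUnion]
  · congr 1
    ext ω
    simp only [Set.mem_iUnion, Set.mem_ofPred_eq]
    constructor
    · rintro ⟨h1, h2⟩
      refine ⟨⟨fun k => W.Y k ω, hΦ _ _ ?_ h1⟩, fun k => rfl, h2⟩
      intro k hk
      simp [extn, Nat.lt_succ_of_le hk]
    · rintro ⟨⟨y, hy⟩, h1, h2⟩
      refine ⟨hΦ _ _ ?_ hy, h2⟩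
      intro k hk
      simp only [extn, Nat.lt_succ_of_le hk, dite_true]
      exact (h1 ⟨k, Nat.lt_succ_of_le hk⟩).symm
  · intro y z hyz
    refine Set.disjoint_left.2 ?_
    rintro ω ⟨h1, -⟩ ⟨h2, -⟩
    exact hyz (Subtype.ext (funext fun k => (h1 k).symm.trans (h2 k)))
  · intro y
    exact (meas_path W n y.1).inter hB

lemma markov (x : Zd d) (n : ℕ) (Φ : (ℕ → Zd d) → Prop)
    (hΦ : ∀ f g : ℕ → Zd d, (∀ k ≤ n, f k = g k) → Φ f → Φ g) (a w : Zd d) (I : Set ℝ)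
    (hI : MeasurableSet I) :
    W.P x {ω | (Φ (fun k => W.Y k ω) ∧ W.Y n ω = a) ∧ W.Y (n+1) ω = w ∧ W.ζ n ω ∈ I}
     = W.P x {ω | Φ (fun k => W.Y k ω) ∧ W.Y n ω = a} * (stepP d (w - a) * expMeasure I) := by
  have hΦ' : ∀ f g : ℕ → Zd d, (∀ k ≤ n, f k = g k) → (Φ f ∧ f n = a) → (Φ g ∧ g n = a) :=
    fun f g h ⟨h1, h2⟩ => ⟨hΦ f g h h1, by rw [← h n le_rfl]; exact h2⟩
  have hB : MeasurableSet {ω | W.Y (n+1) ω = w ∧ W.ζ n ω ∈ I} :=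
    (meas_Yeq W _ _).inter (W.measurable_ζ n hI)
  have h1 := decomp W x n (fun f => Φ f ∧ f n = a) hΦ' _ hB
  have h2 := decomp W x n (fun f => Φ f ∧ f n = a) hΦ' univ MeasurableSet.univ
  simp only [Set.mem_univ, and_true, Set.mem_ofPred_eq] at h1 h2
  rw [h1, h2, ← ENNReal.tsum_mul_right]
  refine tsum_congr fun y => ?_
  rw [path_step W x n y.1 w I hI]
  have : y.1 (Fin.last n) = a := by
    have := y.2.2
    simpa [extn, Fin.last] using this
  rw [this]

lemma sum_Y (x : Zd d) (n : ℕ) (B : Set Ω) (hB : MeasurableSet B) :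
    W.P x B = ∑' a, W.P x {ω | ω ∈ B ∧ W.Y n ω = a} := by
  rw [← measure_iUnion]
  · congr 1
    ext ω; simp
  · intro y z hyz
    refine Set.disjoint_left.2 ?_
    rintro ω ⟨-, h1⟩ ⟨-, h2⟩
    exact hyz (h1.symm.trans h2)
  · intro y
    exact hB.inter (meas_Yeq W n y)

lemma meas_Phi (n : ℕ) (Φ : (ℕ → Zd d) → Prop)
    (hΦ : ∀ f g : ℕ → Zd d, (∀ k ≤ n, f k = g k) → Φ f → Φ g) :
    MeasurableSet {ω | Φ (fun k => W.Y k ω)} := by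
  have : {ω | Φ (fun k => W.Y k ω)} = (fun ω (k : Fin (n+1)) => W.Y k ω) ⁻¹'
      {y | Φ (extn n y)} := by
    ext ω
    simp only [Set.mem_ofPred_eq, Set.mem_preimage]
    constructor <;> intro h <;> refine hΦ _ _ ?_ h <;> intro k hk <;>
      simp [extn, Nat.lt_succ_of_le hk]
  rw [this]
  have hm : Measurable (fun ω (k : Fin (n+1)) => W.Y k ω) :=
    measurable_pi_lambda _ fun k => W.measurable_Y k
  exact hm MeasurableSet.of_discrete

lemma markov1 (x : Zd d) (n : ℕ) (Φ : (ℕ → Zd d) → Prop)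
    (hΦ : ∀ f g : ℕ → Zd d, (∀ k ≤ n, f k = g k) → Φ f → Φ g) (w : Zd d) :
    W.P x {ω | Φ (fun k => W.Y k ω) ∧ W.Y (n+1) ω = w}
     = ∑' a, W.P x {ω | Φ (fun k => W.Y k ω) ∧ W.Y n ω = a} * stepP d (w - a) := by
  refine (sum_Y W x n _ ((meas_Phi W n Φ hΦ).inter (meas_Yeq W (n+1) w))).trans ?_
  refine tsum_congr fun a => ?_
  have := markov W x n Φ hΦ a w univ MeasurableSet.univ
  rw [exp_univ, mul_one] at this
  rw [← this]
  congr 1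
  ext ω
  simp only [Set.mem_ofPred_eq, Set.mem_inter_iff, Set.mem_univ, and_true]
  tauto

lemma P_Y (hd : 0 < d) (x : Zd d) (n : ℕ) (y : Zd d) :
    W.P x {ω | W.Y n ω = y} = ENNReal.ofReal (p n (y - x)) := by
  induction n generalizing y with
  | zero =>
    simp only [p, sub_eq_zero]
    split_ifs with h
    · subst h; rw [W.Y_zero]; simp
    · rw [ENNReal.ofReal_zero]
      refine measure_mono_null ?_ (hY0 W x)
      intro ω h1 h2
      exact h (h1.symm.trans h2)
  | succ n ih =>
    have := markov1 W x n (fun _ => True) (by simp) y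
    simp only [true_and] at this
    rw [this]
    simp only [ih]
    rw [tsum_step]
    simp only [p, avg]
    rw [ENNReal.ofReal_div_of_pos (by positivity), ENNReal.ofReal_sum_of_nonneg
      (fun i _ => add_nonneg (p_nonneg _ _) (p_nonneg _ _)), div_eq_mul_inv]
    congr 1
    · refine Finset.sum_congr rfl fun i _ => ?_
      rw [ENNReal.ofReal_add (p_nonneg _ _) (p_nonneg _ _)]
      congr 3 <;> abel
    · congr 1
      rw [← ENNReal.ofReal_natCast]; push_cast; rfl

lemma P_Yζ (x : Zd d) (n : ℕ) (y : Zd d) (I : Set ℝ) (hI : MeasurableSet I) :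
    W.P x {ω | W.Y n ω = y ∧ W.ζ n ω ∈ I} = W.P x {ω | W.Y n ω = y} * expMeasure I := by
  have h1 := sum_Y W x (n+1) _ ((meas_Yeq W n y).inter (W.measurable_ζ n hI))
  have h2 := sum_Y W x (n+1) _ (meas_Yeq W n y)
  have h3 := fun w => markov W x n (fun _ => True) (by simp) y w I hI
  have h4 := fun w => markov W x n (fun _ => True) (by simp) y w univ MeasurableSet.univ
  simp only [true_and, exp_univ, mul_one, Set.mem_univ, and_true] at h3 h4
  change W.P x {ω | W.Y n ω = y ∧ W.ζ n ω ∈ I} = _ at h1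
  rw [h1, h2, ← ENNReal.tsum_mul_right]
  refine tsum_congr fun w => ?_
  have e1 : {ω | ω ∈ {ω | W.Y n ω = y} ∩ W.ζ n ⁻¹' I ∧ W.Y (n+1) ω = w} =
    {ω | W.Y n ω = y ∧ W.Y (n+1) ω = w ∧ W.ζ n ω ∈ I} := by
    ext ω; simp only [Set.mem_ofPred_eq, Set.mem_inter_iff, Set.mem_preimage]; tauto
  rw [e1, h3]
  have e2 : {ω | ω ∈ {ω | W.Y n ω = y} ∧ W.Y (n+1) ω = w} =
    {ω | W.Y n ω = y ∧ W.Y (n+1) ω = w} := rfl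
  rw [e2, h4, mul_assoc]

lemma P_ζs (x : Zd d) (n : ℕ) (I : Fin n → Set ℝ) (hI : ∀ i, MeasurableSet (I i)) :
    W.P x {ω | ∀ i : Fin n, W.ζ i ω ∈ I i} = ∏ i, expMeasure (I i) := by
  have := W.isProb x
  have hB : MeasurableSet {ω | ∀ i : Fin n, W.ζ i ω ∈ I i} := by
    rw [Set.ofPred_forall]
    exact MeasurableSet.iInter fun k => W.measurable_ζ k (hI k)
  have h1 := decomp W x n (fun _ => True) (by simp) _ hB
  have h2 := decomp W x n (fun _ => True) (by simp) univ MeasurableSet.univ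
  simp only [true_and, Set.mem_univ, and_true, Set.mem_ofPred_eq] at h1 h2
  have h3 : W.P x {ω | True} = 1 := by simp
  rw [h1, ← one_mul (∏ i, expMeasure (I i)), ← h3, h2, ← ENNReal.tsum_mul_right]
  refine tsum_congr fun y => ?_
  rw [path W x n y.1 I hI]
  have := path W x n y.1 (fun _ => univ) (fun _ => MeasurableSet.univ)
  simp only [Set.mem_univ, implies_true, and_true, exp_univ, Finset.prod_const_one, mul_one] at this
  rw [this]
  split_ifs <;> simp

end

end Aux
namespace Aux

noncomputable section

variable {d : ℕ} {Ω : Type*} [MeasurableSpace Ω] (W : SRW d Ω)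

/-- avoid `A` at times in `(n, n+N]` -/
def av (A : Set (Zd d)) (n N : ℕ) (f : ℕ → Zd d) : Prop := ∀ j, n < j → j ≤ n + N → f j ∉ A

lemma av_succ (A : Set (Zd d)) (n N : ℕ) (f : ℕ → Zd d) :
    av A n (N+1) f ↔ av A n N f ∧ f (n+N+1) ∉ A := by
  unfold av
  constructor
  · intro h
    exact ⟨fun j h1 h2 => h j h1 (by omega), h _ (by omega) (by omega)⟩
  · rintro ⟨h1, h2⟩ j h3 h4
    rcases Nat.lt_or_ge (n+N) j with h | h
    · have : j = n+N+1 := by omega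
      rw [this]; exact h2
    · exact h1 j h3 h

lemma killed (x y : Zd d) (A : Set (Zd d)) (n N : ℕ) (w : Zd d) :
    W.P x {ω | (W.Y n ω = y ∧ av A n N (fun k => W.Y k ω)) ∧ W.Y (n+N) ω = w} =
      W.P x {ω | W.Y n ω = y} * W.P y {ω | av A 0 N (fun k => W.Y k ω) ∧ W.Y N ω = w} := by
  induction N generalizing w with
  | zero =>
    have hav : ∀ m (f : ℕ → Zd d), av A m 0 f := by
      intro m f j h1 h2; omega
    simp only [hav, and_true, true_and, Nat.add_zero]
    by_cases h : w = y
    · subst h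
      rw [W.Y_zero, mul_one]
      simp
    · have h1 : {ω | W.Y n ω = y ∧ W.Y n ω = w} = ∅ := by
        ext ω; simp; intro h1 h2; exact h (h2.symm.trans h1)
      have h2 : W.P y {ω | W.Y 0 ω = w} = 0 := by
        refine measure_mono_null ?_ (hY0 W y)
        intro ω h1 h2
        exact h (h1.symm.trans h2)
      rw [h1, h2]; simp
  | succ N ih =>
    by_cases hw : w ∈ A
    · have h1 : {ω | (W.Y n ω = y ∧ av A n (N+1) (fun k => W.Y k ω)) ∧ W.Y (n+(N+1)) ω = w} = ∅ := by
        ext ω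
        simp only [Set.mem_ofPred_eq, Set.mem_empty_iff_false, iff_false]
        rintro ⟨⟨-, h1⟩, h2⟩
        exact h1 (n+(N+1)) (by omega) (by omega) (by simpa only [h2] using hw)
      have h2 : {ω | av A 0 (N+1) (fun k => W.Y k ω) ∧ W.Y (N+1) ω = w} = ∅ := by
        ext ω
        simp only [Set.mem_ofPred_eq, Set.mem_empty_iff_false, iff_false]
        rintro ⟨h1, h2⟩
        exact h1 ((N+1)) (by omega) (by omega) (by simpa only [h2] using hw)
      rw [h1, h2]; simp
    · have h1 : {ω | (W.Y n ω = y ∧ av A n (N+1) (fun k => W.Y k ω)) ∧ W.Y (n+(N+1)) ω = w} =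
          {ω | (W.Y n ω = y ∧ av A n N (fun k => W.Y k ω)) ∧ W.Y (n+N+1) ω = w} := by
        ext ω
        simp only [Set.mem_ofPred_eq, av_succ]
        constructor
        · rintro ⟨⟨h1, h2, h3⟩, h4⟩
          exact ⟨⟨h1, h2⟩, h4⟩
        · rintro ⟨⟨h1, h2⟩, h4⟩
          exact ⟨⟨h1, h2, by rw [h4]; exact hw⟩, h4⟩
      have h2 : {ω | av A 0 (N+1) (fun k => W.Y k ω) ∧ W.Y (N+1) ω = w} =
          {ω | av A 0 N (fun k => W.Y k ω) ∧ W.Y (N+1) ω = w} := by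
        ext ω
        simp only [Set.mem_ofPred_eq, av_succ]
        constructor
        · rintro ⟨⟨h2, h3⟩, h4⟩
          exact ⟨h2, h4⟩
        · rintro ⟨h2, h4⟩
          exact ⟨⟨h2, by rw [Nat.zero_add, h4]; exact hw⟩, h4⟩
      rw [h1, h2, markov1 W x (n+N) (fun f => f n = y ∧ av A n N f) ?_ w,
        markov1 W y N (fun f => av A 0 N f) ?_ w, ← ENNReal.tsum_mul_left]
      · refine tsum_congr fun a => ?_
        rw [← mul_assoc, ← ih a]
      · intro f g h h1 j h2 h3
        rw [← h j (by omega)]; exact h1 j h2 h3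
      · rintro f g h ⟨h0, h1⟩
        refine ⟨by rw [← h n (by omega)]; exact h0, ?_⟩
        intro j h2 h3
        rw [← h j (by omega)]; exact h1 j h2 h3

lemma meas_av (A : Set (Zd d)) (n N : ℕ) : MeasurableSet {ω | av A n N (fun k => W.Y k ω)} := by
  apply meas_Phi W (n+N)
  intro f g h h1 j h2 h3
  rw [← h j (by omega)]; exact h1 j h2 h3

lemma killed' (x y : Zd d) (A : Set (Zd d)) (n N : ℕ) :
    W.P x {ω | W.Y n ω = y ∧ av A n N (fun k => W.Y k ω)} =
      W.P x {ω | W.Y n ω = y} * W.P y {ω | av A 0 N (fun k => W.Y k ω)} := by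
  refine (sum_Y W x (n+N) _ ((meas_Yeq W n y).inter (meas_av W A n N))).trans ?_
  rw [sum_Y W y N _ (meas_av W A 0 N), ← ENNReal.tsum_mul_left]
  exact tsum_congr fun w => killed W x y A n N w

lemma killed_inf (x y : Zd d) (A : Set (Zd d)) (n : ℕ) :
    W.P x {ω | W.Y n ω = y ∧ ∀ j, n < j → W.Y j ω ∉ A} =
      W.P x {ω | W.Y n ω = y} * W.P y {ω | ∀ j, 0 < j → W.Y j ω ∉ A} := by
  have := W.isProb x
  have := W.isProb y
  have e1 : {ω | W.Y n ω = y ∧ ∀ j, n < j → W.Y j ω ∉ A} =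
      ⋂ N, {ω | W.Y n ω = y ∧ av A n N (fun k => W.Y k ω)} := by
    ext ω
    simp only [Set.mem_ofPred_eq, Set.mem_iInter]
    constructor
    · rintro ⟨h1, h2⟩ N
      exact ⟨h1, fun j h3 _ => h2 j h3⟩
    · intro h
      exact ⟨(h 0).1, fun j hj => (h j).2 j hj (by omega)⟩
  have e2 : {ω | ∀ j, 0 < j → W.Y j ω ∉ A} =
      ⋂ N, {ω | av A 0 N (fun k => W.Y k ω)} := by
    ext ω
    simp only [Set.mem_ofPred_eq, Set.mem_iInter]
    constructor
    · intro h2 N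
      exact fun j h3 _ => h2 j h3
    · intro h
      exact fun j hj => (h j) j hj (by omega)
  have t1 := tendsto_measure_iInter_atTop (μ := W.P x)
    (s := fun N => {ω | W.Y n ω = y ∧ av A n N (fun k => W.Y k ω)})
    (fun N => ((meas_Yeq W n y).inter (meas_av W A n N)).nullMeasurableSet)
    (fun N M h ω hω => ⟨hω.1, fun j h1 h2 => hω.2 j h1 (by omega)⟩) ⟨0, measure_ne_top _ _⟩
  have t2 := tendsto_measure_iInter_atTop (μ := W.P y)
    (s := fun N => {ω | av A 0 N (fun k => W.Y k ω)})
    (fun N => (meas_av W A 0 N).nullMeasurableSet)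
    (fun N M h ω hω => fun j h1 h2 => hω j h1 (by omega)) ⟨0, measure_ne_top _ _⟩
  rw [← e1] at t1
  rw [← e2] at t2
  have t3 := ENNReal.Tendsto.const_mul (a := W.P x {ω | W.Y n ω = y}) t2 (Or.inr (measure_ne_top _ _))
  refine tendsto_nhds_unique t1 (t3.congr fun N => ?_)
  exact (killed' W x y A n N).symm

/-! good paths -/

def good (ω : Ω) : Prop := (∀ n, 0 < W.ζ n ω) ∧ ∀ n, ∃ i, n ≤ i ∧ 1 ≤ W.ζ i ω

lemma ae_good (x : Zd d) : ∀ᵐ ω ∂(W.P x), good W ω := by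
  refine Filter.Eventually.and ?_ ?_
  · rw [ae_all_iff]
    intro n
    have h := P_ζs W x (n+1) (Fin.snoc (fun _ => univ) (Iic 0)) (by
      intro i
      induction i using Fin.lastCases with
      | last => simp
      | cast i => simp)
    rw [Fin.prod_univ_castSucc] at h
    simp only [Fin.snoc_last, exp_Iic, mul_zero] at h
    refine measure_mono_null ?_ h
    intro ω hω i
    induction i using Fin.lastCases with
    | last => simpa using hω
    | cast i => simp
  · rw [ae_all_iff]
    intro n
    have key : ∀ m : ℕ, W.P x {ω | ¬ ∃ i, n ≤ i ∧ 1 ≤ W.ζ i ω} ≤ (expMeasure (Iio 1)) ^ m := by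
      intro m
      have h := P_ζs W x (n+m) (fun i => if (i:ℕ) < n then univ else Iio 1) (by
        intro i
        split_ifs <;> simp)
      refine (measure_mono ?_).trans (h.le.trans ?_)
      · intro ω hω i
        simp only [Set.mem_ofPred_eq, not_exists, not_and, not_le] at hω
        split_ifs with h
        · simp
        · exact hω i (by omega)
      · rw [Fin.prod_univ_add]
        simp [exp_univ]
    have t := ENNReal.tendsto_pow_atTop_nhds_zero_of_lt_one exp_Iio_one
    exact le_antisymm (ge_of_tendsto' t key) bot_le

variable {W}

lemma S_succ (n : ℕ) (ω : Ω) : W.S (n+1) ω = W.S n ω + W.ζ n ω := by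
  simp [SRW.S, Finset.sum_range_succ]

lemma S_mono {ω : Ω} (h : good W ω) : StrictMono (fun n => W.S n ω) := by
  apply strictMono_nat_of_lt_succ
  intro n
  rw [S_succ]
  linarith [h.1 n]

lemma S_unb {ω : Ω} (h : good W ω) (t : ℝ) : ∃ n, t < W.S n ω := by
  have key : ∀ m : ℕ, ∃ n, (m : ℝ) ≤ W.S n ω := by
    intro m
    induction m with
    | zero => exact ⟨0, by simp [SRW.S]⟩
    | succ m ih =>
      obtain ⟨n, hn⟩ := ih
      obtain ⟨i, hi, h1⟩ := h.2 n
      refine ⟨i+1, ?_⟩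
      have := (S_mono h).monotone hi
      rw [S_succ]; push_cast; linarith
  obtain ⟨m, hm⟩ := exists_nat_gt t
  obtain ⟨n, hn⟩ := key m
  exact ⟨n, by linarith⟩

lemma jump_eq {ω : Ω} (h : good W ω) {t : ℝ} {n : ℕ} (h1 : W.S n ω ≤ t) (h2 : t < W.S (n+1) ω) :
    W.jumpIdx t ω = n := by
  unfold SRW.jumpIdx
  have : IsGreatest {k : ℕ | W.S k ω ≤ t} n := by
    refine ⟨h1, fun k hk => ?_⟩
    by_contra hc
    push Not at hc
    have := (S_mono h).monotone (show n+1 ≤ k from hc)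
    have hk' : W.S k ω ≤ t := hk
    linarith
  exact this.csSup_eq

lemma exists_idx {ω : Ω} (h : good W ω) {t : ℝ} (ht : 0 ≤ t) :
    ∃ n, W.S n ω ≤ t ∧ t < W.S (n+1) ω := by
  have hu := S_unb h t
  have h0 : Nat.find hu ≠ 0 := by
    intro h0
    have := Nat.find_spec hu
    rw [h0] at this
    simp [SRW.S] at this
    linarith
  obtain ⟨m, hm⟩ := Nat.exists_eq_succ_of_ne_zero h0
  refine ⟨m, ?_, ?_⟩
  · have := Nat.find_min hu (m := m) (by omega)
    linarith
  · have := Nat.find_spec hu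
    rw [hm] at this
    exact this

lemma hit_iff {ω : Ω} (h : good W ω) (A : Set (Zd d)) :
    W.hitTilde A ω = ⊤ ↔ ∀ n, 0 < n → W.Y n ω ∉ A := by
  unfold SRW.hitTilde SRW.hitFrom
  rw [sInf_eq_top]
  constructor
  · intro hh n hn hY
    have hS0 : 0 ≤ W.S n ω := by
      have := (S_mono h).monotone (Nat.zero_le n)
      simpa [SRW.S] using this
    have := hh (((W.S n ω).toNNReal : ℝ≥0) : ℝ≥0∞) ⟨(W.S n ω).toNNReal, rfl, ?_, ?_⟩
    · simp at this
    · have h1 := (S_mono h).monotone (show 1 ≤ n from hn)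
      have h1' : W.ζ 0 ω ≤ W.S n ω := by simpa [SRW.S] using h1
      exact ENNReal.ofReal_le_ofReal h1'
    · rw [Real.coe_toNNReal _ hS0]
      unfold SRW.X
      rw [jump_eq h le_rfl ((S_mono h) (Nat.lt_succ_self n))]
      exact hY
  · rintro hh u ⟨s, rfl, h1, h2⟩
    exfalso
    obtain ⟨n, hn1, hn2⟩ := exists_idx h s.2
    unfold SRW.X at h2
    have e := jump_eq h hn1 hn2
    change W.Y (W.jumpIdx s.1 ω) ω ∈ A at h2
    rw [e] at h2
    rcases Nat.eq_zero_or_pos n with h0 | h0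
    · subst h0
      have h3 : W.ζ 0 ω ≤ s.1 := by
        have := ENNReal.ofReal_le_iff_le_toReal (a := W.ζ 0 ω) (b := (s:ℝ≥0∞)) (by simp)
        exact this.1 h1
      have : W.S (0+1) ω = W.ζ 0 ω := by simp [SRW.S]
      linarith
    · exact hh n h0 h2

lemma eqm_eq (A : Set (Zd d)) (x : Zd d) (hx : x ∈ A) :
    W.eqm A x = (W.P x {ω | ∀ n, 0 < n → W.Y n ω ∉ A}).toReal := by
  unfold SRW.eqm
  rw [if_pos hx]
  congr 1
  apply measure_congr
  filter_upwards [ae_good W x] with ω hω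
  exact propext (hit_iff hω A)

end

end Aux
namespace Aux

noncomputable section

variable {d : ℕ} {Ω : Type*} [MeasurableSpace Ω] (W : SRW d Ω)

def Z (y : Zd d) (ω : Ω) : ℝ≥0∞ := ∑' n, if W.Y n ω = y then ENNReal.ofReal (W.ζ n ω) else 0

lemma inner_eq {ω : Ω} (h : good W ω) (y : Zd d) :
    (∫ s in Set.Ioi (0 : ℝ), if W.X s ω = y then (1 : ℝ) else 0) = (Z W y ω).toReal := by
  rw [← integral_Ici_eq_integral_Ioi]
  let T : ℕ → Set ℝ := fun n => if W.Y n ω = y then Ico (W.S n ω) (W.S (n+1) ω) else ∅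
  have hT : ∀ n, MeasurableSet (T n) := by
    intro n
    simp only [T]
    split_ifs <;> simp
  have hU : MeasurableSet (⋃ n, T n) := MeasurableSet.iUnion hT
  have hS0 : ∀ n, 0 ≤ W.S n ω := by
    intro n
    have := (S_mono h).monotone (Nat.zero_le n)
    simpa [SRW.S] using this
  have e1 : ∀ s ∈ Ici (0:ℝ), (if W.X s ω = y then (1 : ℝ) else 0) = (⋃ n, T n).indicator 1 s := by
    intro s hs
    have : W.X s ω = y ↔ s ∈ ⋃ n, T n := by
      simp only [Set.mem_iUnion, T]
      obtain ⟨m, hm1, hm2⟩ := exists_idx h hs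
      unfold SRW.X
      rw [jump_eq h hm1 hm2]
      constructor
      · intro hY
        exact ⟨m, by rw [if_pos hY]; exact ⟨hm1, hm2⟩⟩
      · rintro ⟨n, hn⟩
        split_ifs at hn with hY
        · have h1 := jump_eq h hn.1 hn.2
          rw [jump_eq h hm1 hm2] at h1
          rw [h1]; exact hY
        · simp at hn
    by_cases hX : W.X s ω = y
    · rw [if_pos hX, Set.indicator_of_mem (this.1 hX)]; rfl
    · rw [if_neg hX, Set.indicator_of_notMem (fun hc => hX (this.2 hc))]
  rw [setIntegral_congr_fun measurableSet_Ici e1, integral_indicator_one hU, measureReal_def,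
    Measure.restrict_apply hU]
  congr 1
  have e2 : (⋃ n, T n) ∩ Ici 0 = ⋃ n, T n := by
    apply Set.inter_eq_left.2
    intro s hs
    obtain ⟨n, hn⟩ := Set.mem_iUnion.1 hs
    simp only [T] at hn
    split_ifs at hn
    · exact (hS0 n).trans hn.1
    · simp at hn
  rw [e2, measure_iUnion _ hT]
  · unfold Z
    refine tsum_congr fun n => ?_
    simp only [T]
    split_ifs
    · rw [Real.volume_Ico, S_succ]; congr 1; ring
    · simp
  · intro m n hmn
    refine Set.disjoint_left.2 fun s h1 h2 => ?_
    simp only [T] at h1 h2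
    split_ifs at h1 with h3
    · split_ifs at h2 with h4
      · exact hmn ((jump_eq h h1.1 h1.2).symm.trans (jump_eq h h2.1 h2.2))
      · simp at h2
    · simp at h1

lemma lint_term (hd : 0 < d) (x y : Zd d) (n : ℕ) :
    ∫⁻ ω, (if W.Y n ω = y then ENNReal.ofReal (W.ζ n ω) else 0) ∂(W.P x) =
      ENNReal.ofReal (p n (y - x)) := by
  have e : ((W.P x).restrict {ω | W.Y n ω = y}).map (W.ζ n) = (W.P x {ω | W.Y n ω = y}) • expMeasure := by
    ext I hI
    rw [Measure.map_apply (W.measurable_ζ n) hI, Measure.restrict_apply (W.measurable_ζ n hI),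
      Measure.smul_apply, smul_eq_mul, ← P_Yζ W x n y I hI]
    congr 1
    ext ω; simp [and_comm]
  have h1 : (fun ω => if W.Y n ω = y then ENNReal.ofReal (W.ζ n ω) else 0) =
    {ω | W.Y n ω = y}.indicator (fun ω => ENNReal.ofReal (W.ζ n ω)) := by
    ext ω; simp [Set.indicator]
  rw [h1, lintegral_indicator (meas_Yeq W n y),
    ← lintegral_map (f := fun t => ENNReal.ofReal t) (by fun_prop) (W.measurable_ζ n), e,
    lintegral_smul_measure, exp_mean, smul_eq_mul, mul_one, P_Y W hd]

lemma meas_term (y : Zd d) (n : ℕ) :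
    Measurable (fun ω => if W.Y n ω = y then ENNReal.ofReal (W.ζ n ω) else 0) :=
  Measurable.ite (meas_Yeq W n y) (W.measurable_ζ n).ennreal_ofReal measurable_const

lemma green_eq (hd : 3 ≤ d) (x y : Zd d) : W.green x y = G0 (y - x) := by
  unfold SRW.green
  have h0 : 0 < d := by omega
  have h1 : ∫⁻ ω, Z W y ω ∂(W.P x) = ENNReal.ofReal (G0 (y - x)) := by
    unfold Z G0
    rw [lintegral_tsum (fun n => (meas_term W y n).aemeasurable),
      ENNReal.ofReal_tsum_of_nonneg (fun n => p_nonneg _ _) (p_summable hd _)]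
    exact tsum_congr fun n => lint_term W h0 x y n
  have hm : Measurable (Z W y) := Measurable.tsum fun n => meas_term W y n
  have h2 : ∀ᵐ ω ∂(W.P x), Z W y ω < ⊤ :=
    ae_lt_top hm (by rw [h1]; exact ENNReal.ofReal_ne_top)
  rw [integral_congr_ae (g := fun ω => (Z W y ω).toReal), integral_toReal hm.aemeasurable h2, h1,
    ENNReal.toReal_ofReal (G0_nonneg _)]
  filter_upwards [ae_good W x] with ω hω
  exact inner_eq W hω y

lemma last_exit (hd : 3 ≤ d) (A : Finset (Zd d)) (x : Zd d) (hx : x ∈ A) :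
    ∑ y ∈ A, G0 (y - x) * W.eqm (A : Set (Zd d)) y = 1 := by
  have h0 : 0 < d := by omega
  have := W.isProb x
  let F : A × ℕ → Set Ω := fun q => {ω | W.Y q.2 ω = q.1.1 ∧ ∀ j, q.2 < j → W.Y j ω ∉ (A : Set (Zd d))}
  have hF : ∀ q, MeasurableSet (F q) := by
    intro q
    refine (meas_Yeq W _ _).inter ?_
    have : {ω | ∀ j, q.2 < j → W.Y j ω ∉ (A : Set (Zd d))} =
      ⋂ j, ⋂ (_ : q.2 < j), {ω | W.Y j ω ∈ (A : Set (Zd d))ᶜ} := by ext ω; simp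
    change MeasurableSet {ω | ∀ j, q.2 < j → W.Y j ω ∉ (A : Set (Zd d))}
    rw [this]
    exact MeasurableSet.iInter fun j => MeasurableSet.iInter fun _ => meas_Y W j _
  have hdisj : Pairwise (Function.onFun Disjoint F) := by
    rintro ⟨y, n⟩ ⟨z, m⟩ hne
    refine Set.disjoint_left.2 ?_
    rintro ω ⟨h1, h2⟩ ⟨h3, h4⟩
    simp only at h1 h2 h3 h4
    have hnm : n = m := by
      rcases lt_trichotomy n m with h | h | h
      · exact absurd (by rw [h3]; exact z.2) (h2 m h)
      · exact h
      · exact absurd (by rw [h1]; exact y.2) (h4 n h)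
    subst hnm
    exact hne (by rw [Prod.mk.injEq]; exact ⟨Subtype.ext (h1.symm.trans h3), rfl⟩)
  have hU : W.P x (⋃ q, F q) = 1 := by
    have hev : ∀ y ∈ A, ∀ᵐ ω ∂(W.P x), ∀ᶠ n in Filter.atTop, W.Y n ω ≠ y := by
      intro y _
      have := measure_setOfPred_frequently_eq_zero (μ := W.P x) (p := fun n ω => W.Y n ω = y) (by
        simp only [P_Y W h0]
        rw [← ENNReal.ofReal_tsum_of_nonneg (fun n => p_nonneg _ _) (p_summable hd _)]
        exact ENNReal.ofReal_ne_top)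
      refine measure_mono_null ?_ this
      intro ω hω hc
      exact hω hc
    have hev2 : ∀ᵐ ω ∂(W.P x), ∀ y ∈ A, ∀ᶠ n in Filter.atTop, W.Y n ω ≠ y :=
      (ae_ball_iff (Finset.countable_toSet A)).2 hev
    have : (⋃ q, F q : Set Ω) =ᵐ[W.P x] (univ : Set Ω) := by
      filter_upwards [hev2, hY0 W x] with ω h1 h2
      apply propext
      refine iff_of_true ?_ trivial
      have h3 : ∀ᶠ n in Filter.atTop, ∀ y ∈ A, W.Y n ω ≠ y := (Filter.eventually_all_finset A).2 h1
      obtain ⟨N, hN⟩ := Filter.eventually_atTop.1 h3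
      have hs : W.Y (Nat.findGreatest (fun n => W.Y n ω ∈ A) N) ω ∈ A :=
        Nat.findGreatest_spec (P := fun n => W.Y n ω ∈ A) (Nat.zero_le N) (by rw [h2]; exact hx)
      refine Set.mem_iUnion.2 ⟨(⟨_, hs⟩, Nat.findGreatest (fun n => W.Y n ω ∈ A) N), rfl, ?_⟩
      intro j hj hA
      rcases le_or_gt j N with hjN | hjN
      · exact Nat.findGreatest_is_greatest hj hjN hA
      · exact hN j hjN.le _ hA rfl
    rw [measure_congr this, measure_univ]
  rw [measure_iUnion hdisj hF, ENNReal.tsum_prod'] at hU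
  have hy : ∀ y : A, ∑' n, W.P x (F (y, n)) =
      ENNReal.ofReal (G0 (y.1 - x) * W.eqm (A : Set (Zd d)) y.1) := by
    intro y
    have := W.isProb y.1
    have : ∀ n, W.P x (F (y, n)) = ENNReal.ofReal (p n (y.1 - x)) *
        W.P y.1 {ω | ∀ j, 0 < j → W.Y j ω ∉ (A : Set (Zd d))} := by
      intro n
      rw [← P_Y W h0]
      exact killed_inf W x y.1 _ n
    simp only [this]
    rw [ENNReal.tsum_mul_right, ← ENNReal.ofReal_tsum_of_nonneg (fun n => p_nonneg _ _) (p_summable hd _),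
      eqm_eq _ _ y.2, ENNReal.ofReal_mul (G0_nonneg _), ENNReal.ofReal_toReal (measure_ne_top _ _)]
    rfl
  simp only [hy] at hU
  rw [tsum_fintype, Finset.sum_coe_sort A
    (fun y => ENNReal.ofReal (G0 (y - x) * W.eqm (A : Set (Zd d)) y)),
    ← ENNReal.ofReal_sum_of_nonneg] at hU
  · exact ENNReal.ofReal_eq_one.1 hU
  · intro y _
    refine mul_nonneg (G0_nonneg _) ?_
    unfold SRW.eqm
    split_ifs <;> simp

end

end Aux
namespace Aux

noncomputable section

variable {d : ℕ} {Ω : Type*} [MeasurableSpace Ω] (W : SRW d Ω)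

lemma algebra {ι α : Type*} (Cs : Finset ι) (D : ι → Finset α) (g : α → α → ℝ)
    (hg : ∀ x y, g x y = g y x) (e : α → ℝ) (he : ∀ x, 0 ≤ e x) (ez : ι → α → ℝ)
    (hez : ∀ z x, 0 ≤ ez z x) (ε : ℝ) (hε : 0 < ε)
    (hz : ∀ z ∈ Cs, ∀ x ∈ D z, ∑ w ∈ D z, g x w * ez z w = 1)
    (hC : ∀ z0 ∈ Cs, ∀ x ∈ D z0, ∑ z ∈ Cs, ∑ w ∈ D z, g x w * e w = 1)
    (hcap : ∀ z ∈ Cs, 0 < ∑ w ∈ D z, ez z w)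
    (hr : ∀ z0 ∈ Cs, ∀ z ∈ Cs, z ≠ z0 → ∀ x ∈ D z0, ∀ x' ∈ D z0, ∀ w ∈ D z, ∀ y ∈ D z,
      g x w ≤ (1 + ε) * g x' y) :
    ∀ z0 ∈ Cs, ∀ x ∈ D z0,
      ∑ z ∈ Cs, (∑ y ∈ D z, e y) / (∑ w ∈ D z, ez z w) * ∑ w ∈ D z, g x w * ez z w ≤ 1 + ε := by
  intro z0 hz0 x hx
  rw [← Finset.add_sum_erase _ _ hz0]
  set R := ∑ z ∈ Cs.erase z0, (∑ y ∈ D z, e y) / (∑ w ∈ D z, ez z w) * ∑ w ∈ D z, g x w * ez z w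
    with hR
  rw [hz z0 hz0 x hx, mul_one]
  have hc0 := hcap z0 hz0
  set c0 := ∑ w ∈ D z0, ez z0 w with hc0'
  set q0 := ∑ y ∈ D z0, e y with hq0
  have hq : 0 ≤ q0 := Finset.sum_nonneg fun y _ => he y
  have h1 : ∀ x' ∈ D z0, R ≤ (1 + ε) * (1 - ∑ y ∈ D z0, g x' y * e y) := by
    intro x' hx'
    have h2 := hC z0 hz0 x' hx'
    rw [← Finset.add_sum_erase _ _ hz0] at h2
    have h3 : 1 - ∑ y ∈ D z0, g x' y * e y = ∑ z ∈ Cs.erase z0, ∑ w ∈ D z, g x' w * e w := by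
      linarith
    rw [h3, hR, Finset.mul_sum]
    refine Finset.sum_le_sum fun z hz' => ?_
    obtain ⟨hne, hzC⟩ := Finset.mem_erase.1 hz'
    rw [div_mul_eq_mul_div, div_le_iff₀ (hcap z hzC), Finset.sum_mul_sum, mul_assoc,
      Finset.sum_mul_sum, Finset.mul_sum]
    simp only [Finset.mul_sum]
    refine Finset.sum_le_sum fun y hy => Finset.sum_le_sum fun w hw => ?_
    have := hr z0 hz0 z hzC hne x hx x' hx' w hw y hy
    have h5 := mul_le_mul_of_nonneg_left this (mul_nonneg (he y) (hez z w))
    linarith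
  have h2 : ∑ x' ∈ D z0, ez z0 x' * R ≤
      ∑ x' ∈ D z0, ez z0 x' * ((1 + ε) * (1 - ∑ y ∈ D z0, g x' y * e y)) :=
    Finset.sum_le_sum fun x' hx' => mul_le_mul_of_nonneg_left (h1 x' hx') (hez _ _)
  have h3 : ∑ x' ∈ D z0, ez z0 x' * ((1 + ε) * (1 - ∑ y ∈ D z0, g x' y * e y)) =
      (1 + ε) * (c0 - ∑ x' ∈ D z0, ez z0 x' * ∑ y ∈ D z0, g x' y * e y) := by
    rw [hc0', ← Finset.sum_sub_distrib, Finset.mul_sum]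
    exact Finset.sum_congr rfl fun _ _ => by ring
  have h4 : ∑ x' ∈ D z0, ez z0 x' * ∑ y ∈ D z0, g x' y * e y = q0 := by
    simp only [Finset.mul_sum]
    rw [Finset.sum_comm, hq0]
    refine Finset.sum_congr rfl fun y hy => ?_
    have := hz z0 hz0 y hy
    calc ∑ x' ∈ D z0, ez z0 x' * (g x' y * e y) = e y * ∑ x' ∈ D z0, g y x' * ez z0 x' := by
          rw [Finset.mul_sum]
          refine Finset.sum_congr rfl fun x' _ => ?_
          rw [hg y x']; ring
      _ = e y := by rw [this, mul_one]
  rw [h3, h4, ← Finset.sum_mul] at h2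
  have h5 : R ≤ (1 + ε) * (c0 - q0) / c0 := by
    rw [le_div_iff₀ hc0]; linarith
  have h6 : (1 + ε) * (c0 - q0) / c0 = (1 + ε) - (1 + ε) * (q0 / c0) := by
    field_simp
  have h7 : 0 ≤ q0 / c0 := by positivity
  nlinarith

lemma avg_shift (w x : Zd d) : avg (fun y => G0 (w - y)) x = avg G0 (x - w) := by
  unfold avg
  congr 1
  refine Finset.sum_congr rfl fun i _ => ?_
  show G0 (w - (x + ee i)) + G0 (w - (x - ee i)) = _
  rw [← G0_neg (w - (x + ee i)), ← G0_neg (w - (x - ee i))]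
  congr 2 <;> abel

lemma offC (hd : 3 ≤ d) (C : Finset (Zd d)) (f : Zd d → ℝ)
    (h : ∀ x ∈ C, 0 ≤ ∑ w ∈ C, f w * G0 (w - x)) (x : Zd d) :
    0 ≤ ∑ w ∈ C, f w * G0 (w - x) := by
  by_cases hx : x ∈ C
  · exact h x hx
  have h0 : 0 < d := by omega
  refine minP h0 (fun x => ∑ w ∈ C, f w * G0 (w - x)) {x | x ∉ C} ?_ ?_ ?_ x hx
  · intro c hc
    set M := ∑ w ∈ C, |f w| + 1 with hM
    have hMp : 0 < M := by positivity
    have hc' : 0 < -c / M := div_pos (by linarith) hMp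
    refine Set.Finite.subset (Set.Finite.biUnion C.finite_toSet
      (t := fun w => (fun x => w - x) ⁻¹' {x | -c / M ≤ G0 x}) fun w _ =>
        (G0_decay hd _ hc').preimage (sub_right_injective.injOn)) ?_
    rintro y ⟨-, hy⟩
    by_contra hcon
    simp only [Set.mem_iUnion, Set.mem_preimage, Set.mem_ofPred_eq, not_exists, not_le] at hcon
    have : -∑ w ∈ C, f w * G0 (w - y) ≤ ∑ w ∈ C, |f w| * (-c / M) := by
      rw [← Finset.sum_neg_distrib]
      refine Finset.sum_le_sum fun w hw => ?_
      have h1 := (hcon w hw).le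
      have h2 := mul_le_mul_of_nonneg_left h1 (abs_nonneg (f w))
      have h3 := mul_le_mul_of_nonneg_right (neg_le_abs (f w)) (G0_nonneg (w - y))
      linarith
    rw [← Finset.sum_mul] at this
    have e1 : ∑ w ∈ C, |f w| = M - 1 := by rw [hM]; ring
    rw [e1] at this
    have e2 : (M - 1) * (-c / M) = -c - (-c / M) := by field_simp; ring
    linarith
  · intro y hy
    rw [avg_sum]
    refine Finset.sum_le_sum fun w hw => le_of_eq ?_
    have := avg_mul (f w) (fun y => G0 (w - y)) y
    rw [this, avg_shift, G0_harm hd _ (by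
      intro h; rw [sub_eq_zero] at h; subst h; exact hy hw), ← G0_neg (w - y), neg_sub]
  · intro y hy hlt i
    constructor <;> intro hc <;> simp only [Set.mem_ofPred_eq, not_not] at hc <;>
      exact lt_of_lt_of_le hlt (h _ hc)

lemma eqm_nonneg (A : Set (Zd d)) (x : Zd d) : 0 ≤ W.eqm A x := by
  unfold SRW.eqm
  split_ifs <;> simp

lemma eqm_off (A : Set (Zd d)) (x : Zd d) (hx : x ∉ A) : W.eqm A x = 0 := by
  unfold SRW.eqm
  rw [if_neg hx]

lemma cap_eq (A : Finset (Zd d)) : W.cap (A : Set (Zd d)) = ∑ x ∈ A, W.eqm (A : Set (Zd d)) x := by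
  unfold SRW.cap
  apply finsum_eq_sum_of_support_subset
  intro x hx
  by_contra hc
  exact hx (eqm_off W _ x hc)

lemma Gop_eq (hd : 3 ≤ d) (C : Finset (Zd d)) (f : Zd d → ℝ) (hf : ∀ x, x ∉ C → f x = 0) (x : Zd d) :
    W.Gop f x = ∑ w ∈ C, f w * G0 (w - x) := by
  unfold SRW.Gop
  rw [finsum_eq_sum_of_support_subset (s := C)]
  · exact Finset.sum_congr rfl fun w _ => by rw [green_eq W hd, mul_comm]
  · intro y hy
    by_contra hc
    exact hy (by simp only; rw [hf y hc, mul_zero])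

lemma core (hd : 3 ≤ d) (ε : ℝ) (hε : 0 < ε) (Cs : Finset (Zd d)) (D : Zd d → Finset (Zd d))
    (hne : ∀ z ∈ Cs, (D z).Nonempty)
    (hdisj : ∀ z ∈ Cs, ∀ z' ∈ Cs, z ≠ z' → Disjoint (D z) (D z'))
    (hr : ∀ z0 ∈ Cs, ∀ z ∈ Cs, z ≠ z0 → ∀ x ∈ D z0, ∀ x' ∈ D z0, ∀ w ∈ D z, ∀ y ∈ D z,
      G0 (w - x) ≤ (1 + ε) * G0 (y - x')) (x : Zd d) :
    W.Gop (fun w => ∑ z ∈ Cs, (∑ y ∈ D z, W.eqm (Cs.biUnion D : Finset (Zd d)) y) *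
      W.ebar (D z : Set (Zd d)) w) x ≤ (1 + ε) * W.Gop (W.eqm (Cs.biUnion D : Finset (Zd d))) x := by
  set C := Cs.biUnion D with hCdef
  set e := W.eqm (C : Set (Zd d)) with hedef
  set V : Zd d → ℝ := fun w => ∑ z ∈ Cs, (∑ y ∈ D z, e y) * W.ebar (D z : Set (Zd d)) w with hV
  have heC : ∀ x, x ∉ C → e x = 0 := fun x hx => eqm_off W _ x hx
  have hVC : ∀ x, x ∉ C → V x = 0 := by
    intro x hx
    refine Finset.sum_eq_zero fun z hz => ?_
    have : x ∉ (D z : Set (Zd d)) := fun h => hx (Finset.mem_biUnion.2 ⟨z, hz, h⟩)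
    unfold SRW.ebar
    rw [eqm_off W _ _ this]; simp
  rw [Gop_eq W hd C V hVC, Gop_eq W hd C e heC, ← sub_nonneg, Finset.mul_sum,
    ← Finset.sum_sub_distrib]
  have hshape : ∀ x, ∑ w ∈ C, ((1 + ε) * (e w * G0 (w - x)) - V w * G0 (w - x)) =
      ∑ w ∈ C, ((1 + ε) * e w - V w) * G0 (w - x) :=
    fun x => Finset.sum_congr rfl fun w _ => by ring
  rw [hshape]
  refine offC hd C _ ?_ x
  intro x hx
  rw [← hshape, Finset.sum_sub_distrib, ← Finset.mul_sum, sub_nonneg]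
  have h1 : ∀ x ∈ C, ∑ w ∈ C, e w * G0 (w - x) = 1 := by
    intro x hx
    rw [← last_exit W hd C x hx]
    exact Finset.sum_congr rfl fun w _ => mul_comm _ _
  rw [h1 x hx, mul_one]
  have hz : ∀ z ∈ Cs, ∀ x ∈ D z, ∑ w ∈ D z, G0 (w - x) * W.eqm (D z : Set (Zd d)) w = 1 :=
    fun z _ x hx => last_exit W hd (D z) x hx
  have hVx : ∑ w ∈ C, V w * G0 (w - x) = ∑ z ∈ Cs, (∑ y ∈ D z, e y) /
      (∑ w ∈ D z, W.eqm (D z : Set (Zd d)) w) *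
      ∑ w ∈ D z, G0 (w - x) * W.eqm (D z : Set (Zd d)) w := by
    have e0 : ∀ w, V w * G0 (w - x) = ∑ z ∈ Cs,
        (∑ y ∈ D z, e y) * W.ebar (D z : Set (Zd d)) w * G0 (w - x) := fun w => by
      simp only [hV]; rw [Finset.sum_mul]
    simp only [e0]
    rw [Finset.sum_comm]
    refine Finset.sum_congr rfl fun z hz => ?_
    rw [← Finset.sum_subset (Finset.subset_biUnion_of_mem D hz), Finset.mul_sum]
    · refine Finset.sum_congr rfl fun w _ => ?_
      unfold SRW.ebar
      rw [cap_eq]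
      ring
    · intro w _ hw
      unfold SRW.ebar
      rw [eqm_off W _ w (by simpa using hw)]; simp
  rw [hVx]
  obtain ⟨z0, hz0, hxz⟩ := Finset.mem_biUnion.1 hx
  refine algebra Cs D (fun x w => G0 (w - x)) ?_ e (fun y => eqm_nonneg W _ y)
    (fun z => W.eqm (D z : Set (Zd d))) (fun z y => eqm_nonneg W _ y) ε hε hz ?_ ?_ hr z0 hz0 x hxz
  · intro a b; rw [← G0_neg, neg_sub]
  · intro z1 hz1 y hy
    rw [← h1 y (Finset.mem_biUnion.2 ⟨z1, hz1, hy⟩), hCdef, Finset.sum_biUnion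
      (fun z hz z' hz' h => hdisj z hz z' hz' h)]
    exact Finset.sum_congr rfl fun z _ => Finset.sum_congr rfl fun w _ => mul_comm _ _
  · intro z hzC
    refine lt_of_le_of_ne (Finset.sum_nonneg fun w _ => eqm_nonneg W _ w) ?_
    intro h0
    obtain ⟨y, hy⟩ := hne z hzC
    have h2 := (Finset.sum_eq_zero_iff_of_nonneg (fun w _ => eqm_nonneg W _ w)).1 h0.symm
    have h3 := hz z hzC y hy
    rw [Finset.sum_eq_zero (fun w hw => by rw [h2 w hw, mul_zero])] at h3
    exact zero_ne_one h3

end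

end Aux

/-- Proposition 3.1: `GV ≤ (1+ε)·h_C`, where `C = ∪_{z∈𝒞} D_z`,
`V = Σ_{z∈𝒞} e_C(D_z)·ē_{D_z}` and `h_C = G e_C` is the equilibrium potential of `C`. -/
theorem statement10 {d : ℕ} (hd : 3 ≤ d) {Ω : Type*} [MeasurableSpace Ω] (W : SRW d Ω)
    (ε : ℝ) (hε0 : 0 < ε) (hε1 : ε < 1) :
    ∃ c₅ : ℝ, ∀ (L K : ℕ), 1 ≤ L → c₅ ≤ (K : ℝ) → 100 ≤ K →
      ∀ D₀ : Finset (Zd d), isBox (D₀ : Set (Zd d)) →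
        (intBox 0 (L : ℤ) : Set (Zd d)) ⊆ (D₀ : Set (Zd d)) →
        (D₀ : Set (Zd d)) ⊆ intBox (-(3 * L : ℤ)) (4 * L) →
        ∀ 𝒞 : Finset (Zd d), 𝒞.Nonempty →
          (∀ z ∈ 𝒞, ∀ i, (L : ℤ) ∣ z i) →
          (∀ z ∈ 𝒞, ∀ z' ∈ 𝒞, z ≠ z' → (2 * K + 3) * L ≤ supDist z z') →
          ∀ x : Zd d,
            W.Gop
                (fun w => ∑ z ∈ 𝒞,
                  (∑ y ∈ D₀,
                      W.eqm (⋃ z' ∈ (𝒞 : Set (Zd d)), (z' + ·) '' (D₀ : Set (Zd d)))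
                        (z + y)) *
                    W.ebar ((z + ·) '' (D₀ : Set (Zd d))) w) x
              ≤ (1 + ε) *
                W.Gop
                  (W.eqm (⋃ z' ∈ (𝒞 : Set (Zd d)), (z' + ·) '' (D₀ : Set (Zd d)))) x := by
  obtain ⟨c, hc⟩ := Aux.ratio_final hd ε hε0
  refine ⟨c, ?_⟩
  intro L K hL hcK hK D₀ _ hD1 hD2 Cs _ _ hdist x
  have hbox : ∀ y ∈ D₀, ∀ i, -(3 * L : ℤ) ≤ y i ∧ y i < 4 * L := fun y hy => hD2 hy
  have hfar : ∀ z ∈ Cs, ∀ z' ∈ Cs, z ≠ z' → ∃ i, (2 * K + 3) * (L : ℤ) ≤ |z i - z' i| := by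
    intro z hz z' hz' hne
    have h := hdist z hz z' hz' hne
    unfold supDist at h
    have hpos : (⊥ : ℕ) < (2 * K + 3) * L := by
      show 0 < _
      positivity
    obtain ⟨i, -, hi⟩ := (Finset.le_sup_iff hpos).1 h
    refine ⟨i, ?_⟩
    rw [Int.abs_eq_natAbs]
    exact_mod_cast hi
  have hLK : (100 : ℤ) * L ≤ K * L := by
    exact_mod_cast Nat.mul_le_mul_right L hK
  have hL' : (1 : ℤ) ≤ L := by exact_mod_cast hL
  let D : Zd d → Finset (Zd d) := fun z => D₀.image (z + ·)
  have hDc : ∀ z, (D z : Set (Zd d)) = (z + ·) '' (D₀ : Set (Zd d)) := by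
    intro z; simp [D]
  have hCc : ((Cs.biUnion D : Finset (Zd d)) : Set (Zd d)) =
      ⋃ z' ∈ (Cs : Set (Zd d)), (z' + ·) '' (D₀ : Set (Zd d)) := by
    rw [Finset.coe_biUnion]
    simp only [hDc]
  have key := Aux.core W hd ε hε0 Cs D ?_ ?_ ?_ x
  · rw [hCc] at key
    simp only [hDc] at key
    have hs : ∀ (z : Zd d) (f : Zd d → ℝ), ∑ y ∈ D z, f y = ∑ y ∈ D₀, f (z + y) := by
      intro z f
      exact Finset.sum_image (fun a _ b _ h => add_left_cancel h)
    simp only [hs] at key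
    exact key
  · intro z _
    refine ⟨z + 0, Finset.mem_image_of_mem _ (hD1 ?_)⟩
    intro i
    constructor
    · simp
    · show (0 : ℤ) < L
      linarith
  · intro z hz z' hz' hne
    rw [Finset.disjoint_left]
    intro w hw hw'
    obtain ⟨a, ha, rfl⟩ := Finset.mem_image.1 hw
    obtain ⟨b, hb, hab⟩ := Finset.mem_image.1 hw'
    obtain ⟨i, hi⟩ := hfar z hz z' hz' hne
    have h1 := hbox a ha i
    have h2 := hbox b hb i
    have h3 : z' i + b i = z i + a i := congrFun hab i
    have h4 : |z i - z' i| < 7 * L := by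
      rw [abs_lt]; constructor <;> linarith
    linarith
  · intro z0 hz0 z hz hne a ha a' ha' w hw y hy
    obtain ⟨a, ha2, rfl⟩ := Finset.mem_image.1 ha
    obtain ⟨a', ha'2, rfl⟩ := Finset.mem_image.1 ha'
    obtain ⟨w, hw2, rfl⟩ := Finset.mem_image.1 hw
    obtain ⟨y, hy2, rfl⟩ := Finset.mem_image.1 hy
    refine hc L K hL hcK hK _ _ ?_ ?_
    · intro i
      have h1 := hbox a ha2 i
      have h2 := hbox a' ha'2 i
      have h3 := hbox w hw2 i
      have h4 := hbox y hy2 i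
      simp only [Pi.sub_apply, Pi.add_apply]
      rw [abs_le]; constructor <;> linarith
    · obtain ⟨i, hi⟩ := hfar z hz z0 hz0 hne
      refine ⟨i, ?_⟩
      have h2 := hbox a' ha'2 i
      have h4 := hbox y hy2 i
      simp only [Pi.sub_apply, Pi.add_apply]
      have h5 : |y i - a' i| ≤ 7 * L := by
        rw [abs_le]; constructor <;> linarith
      have h6 := abs_sub_abs_le_abs_sub (z i - z0 i) (-(y i - a' i))
      rw [abs_neg] at h6
      have h7 : z i + y i - (z0 i + a' i) = z i - z0 i - -(y i - a' i) := by ring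
      rw [h7]
      linarith
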